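/- arXiv:2311.15666 — 3 statements merged into one kernel-verified Lean document; each statement's English description precedes it below -/
import Mathlib

section
/- For every integer a ≥ 6 the following identity of complex numbers holds: ((1 + i^(a+1))/(π^(a−1)·(1+i)^(a−3))) · ∫_0^∞ x^a/(cos x − cosh x)^3 dx = −(a(a−1)/2)·Σ_{n=1}^∞ (−1)^n n^(a−2)/sinh(nπ)^3 + 3aπ·Σ_{n=1}^∞ (−1)^n n^(a−1) cosh(nπ)/sinh(nπ)^4 − 5π²·Σ_{n=1}^∞ (−1)^n n^a/sinh(nπ)^3 − 6π²·Σ_{n=1}^∞ (−1)^n n^a/sinh(nπ)^5. -/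
open Real

open Complex in
/-- The integral of `F` along the boundary, counterclockwise, of the trapezoid
`α ≤ Re z ≤ β`, `|Im z| ≤ Re z`. -/
noncomputable def trapezoidIntegral (F : ℂ → ℂ) (α β : ℝ) : ℂ :=
  (∫ t in α..β, F (t * (1 - I)) * (1 - I)) + (∫ y in (-β)..β, F (β + y * I) * I)
    - (∫ t in α..β, F (t * (1 + I)) * (1 + I)) - ∫ y in (-α)..α, F (α + y * I) * I

theorem integral_segment_eq_sub {F Φ : ℂ → ℂ} {c v : ℂ} {a b : ℝ}
    (hΦ : ∀ t ∈ Set.uIcc a b, HasDerivAt Φ (F (c + t * v)) (c + t * v))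
    (hF : ContinuousOn (fun t : ℝ => F (c + t * v)) (Set.uIcc a b)) :
    ∫ t in a..b, F (c + t * v) * v = Φ (c + b * v) - Φ (c + a * v) := by
  refine intervalIntegral.integral_eq_sub_of_hasDerivAt (f := fun t : ℝ => Φ (c + t * v)) ?_
    (hF.mul continuousOn_const).intervalIntegrable
  intro t ht
  have h : HasDerivAt (fun t : ℝ => c + (t : ℂ) * v) v t := by
    simpa using ((Complex.ofRealCLM.hasDerivAt (x := t)).mul_const v).const_add c
  exact (hΦ t ht).comp t h

theorem hasDerivAt_add_log_sub {F Ψ : ℂ → ℂ} {c p z : ℂ}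
    (hΨ : HasDerivAt Ψ (F z - c / (z - p)) z) (hz : z - p ∈ Complex.slitPlane) :
    HasDerivAt (fun w => Ψ w + c * Complex.log (w - p)) (F z) z := by
  have h := hΨ.add (((((hasDerivAt_id z).sub_const p).clog hz)).const_mul c)
  refine h.congr_deriv ?_
  simp only [id]
  ring

theorem hasDerivAt_add_log_sub_rev {F Ψ : ℂ → ℂ} {c p z : ℂ}
    (hΨ : HasDerivAt Ψ (F z - c / (z - p)) z) (hz : p - z ∈ Complex.slitPlane) :
    HasDerivAt (fun w => Ψ w + c * Complex.log (p - w)) (F z) z := by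
  have h := hΨ.add (((((hasDerivAt_id z).const_sub p).clog hz)).const_mul c)
  refine h.congr_deriv ?_
  simp only [id]
  rw [← neg_sub p z, div_neg, neg_div, div_eq_mul_inv c, div_eq_mul_inv 1]
  ring

theorem log_neg_of_im_pos {z : ℂ} (hz : 0 < z.im) :
    Complex.log (-z) = Complex.log z - π * Complex.I := by
  rw [Complex.log, Complex.log, norm_neg, Complex.arg_neg_eq_arg_sub_pi_of_im_pos hz]
  push_cast
  ring

theorem log_neg_of_im_neg {z : ℂ} (hz : z.im < 0) :
    Complex.log (-z) = Complex.log z + π * Complex.I := by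
  rw [Complex.log, Complex.log, norm_neg, Complex.arg_neg_eq_arg_add_pi_of_im_neg hz]
  push_cast
  ring

open Complex in
/-- Residue theorem on a trapezoid for a function which is, up to a derivative, a simple
fraction with pole at a real point `p`. -/
theorem trapezoidIntegral_eq_of_hasDerivAt {F Ψ : ℂ → ℂ} {c : ℂ} {l r p α β : ℝ}
    (hα : 0 < α) (hl : l < α) (hαp : α < p) (hpβ : p < β) (hr : β < r)
    (hΨ : ∀ z : ℂ, l < z.re → z.re < r → z ≠ p → HasDerivAt Ψ (F z - c / (z - p)) z)
    (hF : ContinuousOn F {z : ℂ | l < z.re ∧ z.re < r ∧ z ≠ p}) :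
    trapezoidIntegral F α β = 2 * π * I * c := by
  have hαβ : α < β := hαp.trans hpβ
  have key : ∀ (Φ : ℂ → ℂ) (d v : ℂ) (a b : ℝ),
      (∀ t ∈ Set.uIcc a b, l < (d + t * v).re ∧ (d + t * v).re < r ∧ d + t * v ≠ p) →
      (∀ t ∈ Set.uIcc a b, HasDerivAt Φ (F (d + t * v)) (d + t * v)) →
      ∫ t in a..b, F (d + t * v) * v = Φ (d + b * v) - Φ (d + a * v) := by
    intro Φ d v a b hmem hΦ
    refine integral_segment_eq_sub hΦ (hF.comp (by fun_prop) hmem)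
  have hbot := key (fun w => Ψ w + c * log (w - p)) 0 (1 - I) α β
  have htop := key (fun w => Ψ w + c * log (w - p)) 0 (1 + I) α β
  have hright := key (fun w => Ψ w + c * log (w - p)) β I (-β) β
  have hleft := key (fun w => Ψ w + c * log (p - w)) α I (-α) α
  have e1 : log (p - (α + α * I)) = log (α + α * I - p) - π * I := by
    rw [← log_neg_of_im_pos (by simpa using hα), neg_sub]
  have e2 : log (p - (α - α * I)) = log (α - α * I - p) + π * I := by
    rw [← log_neg_of_im_neg (by simpa using hα), neg_sub]
  simp only [zero_add] at hbot htop
  have ne_of_im : ∀ z : ℂ, z.im ≠ 0 → z ≠ p := by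
    rintro z hz rfl
    simp at hz
  have ne_of_re : ∀ z : ℂ, z.re ≠ p → z ≠ p := by
    rintro z hz rfl
    simp at hz
  have mbot : ∀ t ∈ Set.uIcc α β, l < ((t : ℂ) * (1 - I)).re ∧ ((t : ℂ) * (1 - I)).re < r ∧
      (t : ℂ) * (1 - I) ≠ p := by
    intro t ht
    rw [Set.uIcc_of_le hαβ.le] at ht
    refine ⟨by simp; linarith [ht.1], by simp; linarith [ht.2], ne_of_im _ ?_⟩
    simp
    linarith [ht.1]
  have mtop : ∀ t ∈ Set.uIcc α β, l < ((t : ℂ) * (1 + I)).re ∧ ((t : ℂ) * (1 + I)).re < r ∧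
      (t : ℂ) * (1 + I) ≠ p := by
    intro t ht
    rw [Set.uIcc_of_le hαβ.le] at ht
    refine ⟨by simp; linarith [ht.1], by simp; linarith [ht.2], ne_of_im _ ?_⟩
    simp
    linarith [ht.1]
  have mright : ∀ t ∈ Set.uIcc (-β) β, l < ((β : ℂ) + t * I).re ∧ ((β : ℂ) + t * I).re < r ∧
      (β : ℂ) + t * I ≠ p :=
    fun t _ => ⟨by simp; linarith, by simp; linarith, ne_of_re _ (by simpa using hpβ.ne')⟩
  have mleft : ∀ t ∈ Set.uIcc (-α) α, l < ((α : ℂ) + t * I).re ∧ ((α : ℂ) + t * I).re < r ∧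
      (α : ℂ) + t * I ≠ p :=
    fun t _ => ⟨by simp; linarith, by simp; linarith, ne_of_re _ (by simpa using hαp.ne)⟩
  have ibot := hbot mbot fun t ht => hasDerivAt_add_log_sub
    (hΨ _ (mbot t ht).1 (mbot t ht).2.1 (mbot t ht).2.2) (by
      rw [Set.uIcc_of_le hαβ.le] at ht
      right
      simp
      linarith [ht.1])
  have itop := htop mtop fun t ht => hasDerivAt_add_log_sub
    (hΨ _ (mtop t ht).1 (mtop t ht).2.1 (mtop t ht).2.2) (by
      rw [Set.uIcc_of_le hαβ.le] at ht
      right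
      simp
      linarith [ht.1])
  have iright := hright mright fun t ht => hasDerivAt_add_log_sub
    (hΨ _ (mright t ht).1 (mright t ht).2.1 (mright t ht).2.2) (by left; simpa using hpβ)
  have ileft := hleft mleft fun t ht => hasDerivAt_add_log_sub_rev
    (hΨ _ (mleft t ht).1 (mleft t ht).2.1 (mleft t ht).2.2) (by left; simpa using hαp)
  rw [trapezoidIntegral, ibot, itop, iright, ileft]
  have n1 : (α : ℂ) * (1 + I) = α + α * I := by ring
  have n2 : (α : ℂ) * (1 - I) = α - α * I := by ring
  have n3 : (β : ℂ) * (1 + I) = β + β * I := by ring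
  have n4 : (β : ℂ) * (1 - I) = β - β * I := by ring
  have n5 : (α : ℂ) + ((-α : ℝ) : ℂ) * I = α - α * I := by push_cast; ring
  have n6 : (β : ℂ) + ((-β : ℝ) : ℂ) * I = β - β * I := by push_cast; ring
  rw [n1, n2, n3, n4, n5, n6, e1, e2]
  ring

/-- Adjacent trapezoids add up. -/
theorem trapezoidIntegral_add {F : ℂ → ℂ} {α β γ : ℝ} (hαβ : α ≤ β) (hβγ : β ≤ γ)
    (h₁ : ContinuousOn (fun t : ℝ => F (t * (1 - Complex.I))) (Set.Icc α γ))
    (h₂ : ContinuousOn (fun t : ℝ => F (t * (1 + Complex.I))) (Set.Icc α γ)) :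
    trapezoidIntegral F α β + trapezoidIntegral F β γ = trapezoidIntegral F α γ := by
  have key : ∀ (f : ℝ → ℂ) (v : ℂ), ContinuousOn f (Set.Icc α γ) →
      (∫ t in α..β, f t * v) + (∫ t in β..γ, f t * v) = ∫ t in α..γ, f t * v := by
    intro f v hf
    refine intervalIntegral.integral_add_adjacent_intervals
      (ContinuousOn.intervalIntegrable ?_) (ContinuousOn.intervalIntegrable ?_)
    · rw [Set.uIcc_of_le hαβ]
      exact (hf.mono (Set.Icc_subset_Icc_right hβγ)).mul continuousOn_const
    · rw [Set.uIcc_of_le hβγ]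
      exact (hf.mono (Set.Icc_subset_Icc_left hαβ)).mul continuousOn_const
  rw [trapezoidIntegral, trapezoidIntegral, trapezoidIntegral, ← key _ _ h₁, ← key _ _ h₂]
  ring

theorem complex_sin_ne_zero {z : ℂ} {n : ℤ} (h₁ : (n - 1) * π < z.re) (h₂ : z.re < (n + 1) * π)
    (hz : z ≠ n * π) : Complex.sin z ≠ 0 := by
  intro h
  obtain ⟨k, rfl⟩ := Complex.sin_eq_zero_iff.1 h
  have hre : ((k : ℂ) * (π : ℂ)).re = k * π := by
    rw [Complex.re_mul_ofReal, Complex.intCast_re]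
  rw [hre] at h₁ h₂
  have h₁' := lt_of_mul_lt_mul_right h₁ pi_pos.le
  have h₂' := lt_of_mul_lt_mul_right h₂ pi_pos.le
  norm_cast at h₁' h₂'
  obtain rfl : k = n := by omega
  exact hz rfl

theorem sinh_re_le_norm_sinh (z : ℂ) : Real.sinh z.re ≤ ‖Complex.sinh z‖ := by
  rw [Complex.sinh, Real.sinh_eq, norm_div, ← Complex.norm_exp, ← Complex.neg_re,
    ← Complex.norm_exp]
  simpa using div_le_div_of_nonneg_right
    (norm_sub_norm_le (Complex.exp z) (Complex.exp (-z))) zero_le_two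

theorem complex_sinh_ne_zero {z : ℂ} (hz : 0 < z.re) : Complex.sinh z ≠ 0 :=
  norm_pos_iff.1 ((Real.sinh_pos_iff.2 hz).trans_le (sinh_re_le_norm_sinh z))

theorem abs_sin_re_le_norm_sin (z : ℂ) : |Real.sin z.re| ≤ ‖Complex.sin z‖ := by
  have h : (Complex.sin z).re = Real.sin z.re * Real.cosh z.im := by
    rw [Complex.sin_eq]
    simp [← Complex.ofReal_sin, ← Complex.ofReal_cosh, ← Complex.ofReal_cos, ← Complex.ofReal_sinh]
  refine le_trans ?_ (Complex.abs_re_le_norm _)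
  rw [h, abs_mul, abs_of_pos (Real.cosh_pos _)]
  exact le_mul_of_one_le_right (abs_nonneg _) (Real.one_le_cosh _)

/-- The integrand `z ^ a / (sin z * sinh z) ^ 3`, which is the integrand of the theorem after
a rotation. -/
noncomputable def sinSinhKernel (a : ℕ) (z : ℂ) : ℂ := z ^ a / (Complex.sin z * Complex.sinh z) ^ 3

/-- Half of `f'' + f` for `f z = z ^ a / sinh z ^ 3`. -/
noncomputable def residueDensity (a : ℕ) (z : ℂ) : ℂ :=
  (a : ℂ) * (a - 1) / 2 * z ^ (a - 2) / Complex.sinh z ^ 3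
    - 3 * a * z ^ (a - 1) * Complex.cosh z / Complex.sinh z ^ 4
    + 5 * z ^ a / Complex.sinh z ^ 3 + 6 * z ^ a / Complex.sinh z ^ 5

/-- A function whose derivative is the difference between the kernel and a function with simple
poles. -/
noncomputable def kernelPotential (a : ℕ) (z : ℂ) : ℂ :=
  -(z ^ a / Complex.sinh z ^ 3 * (Complex.cos z / Complex.sin z ^ 2)
    + (a * z ^ (a - 1) / Complex.sinh z ^ 3
      - 3 * z ^ a * Complex.cosh z / Complex.sinh z ^ 4) / Complex.sin z) / 2

theorem hasDerivAt_kernelPotential {a : ℕ} (ha : 2 ≤ a) {z : ℂ} (h₁ : Complex.sin z ≠ 0)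
    (h₂ : Complex.sinh z ≠ 0) :
    HasDerivAt (kernelPotential a)
      (sinSinhKernel a z - residueDensity a z / Complex.sin z) z := by
  have hs := Complex.hasDerivAt_sin z
  have hc := Complex.hasDerivAt_cos z
  have hsh := Complex.hasDerivAt_sinh z
  have hch := Complex.hasDerivAt_cosh z
  have h := ((((hasDerivAt_pow a z).div (hsh.pow 3) (pow_ne_zero 3 h₂)).mul
    (hc.div (hs.pow 2) (pow_ne_zero 2 h₁))).add
    (((((hasDerivAt_pow (a - 1) z).const_mul (a : ℂ)).div (hsh.pow 3) (pow_ne_zero 3 h₂)).sub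
      ((((hasDerivAt_pow a z).const_mul 3).mul hch).div (hsh.pow 4) (pow_ne_zero 4 h₂))).div hs
      h₁)).neg.div_const 2
  refine h.congr_deriv ?_
  obtain ⟨b, rfl⟩ := Nat.exists_eq_add_of_le' ha
  have e1 : b + 2 - 1 = b + 1 := rfl
  have e2 : b + 1 - 1 = b := rfl
  have e3 : b + 2 - 2 = b := rfl
  have hcos : Complex.cos z ^ 2 = 1 - Complex.sin z ^ 2 := by
    rw [← Complex.sin_sq_add_cos_sq z]; ring
  have hcosh : Complex.cosh z ^ 2 = 1 + Complex.sinh z ^ 2 := by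
    rw [← Complex.cosh_sq_sub_sinh_sq z]; ring
  simp only [sinSinhKernel, residueDensity, e1, e2, e3, Pi.pow_apply, Pi.div_apply, Pi.mul_apply, Pi.sub_apply]
  push_cast
  generalize Complex.cos z = c at *
  generalize Complex.sin z = s at *
  generalize Complex.cosh z = C at *
  generalize Complex.sinh z = S at *
  clear h hs hc hsh hch
  field_simp
  linear_combination 2 * S ^ 2 * z ^ (b + 2) * hcos - 12 * s ^ 2 * z ^ (b + 2) * hcosh

theorem differentiableAt_residueDensity (a : ℕ) {z : ℂ} (hz : Complex.sinh z ≠ 0) :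
    DifferentiableAt ℂ (residueDensity a) z := by
  unfold residueDensity
  have h3 := pow_ne_zero 3 hz
  have h4 := pow_ne_zero 4 hz
  have h5 := pow_ne_zero 5 hz
  fun_prop (disch := assumption)

theorem continuousAt_sinSinhKernel (a : ℕ) {z : ℂ} (h₁ : Complex.sin z ≠ 0)
    (h₂ : Complex.sinh z ≠ 0) : ContinuousAt (sinSinhKernel a) z := by
  unfold sinSinhKernel
  have h := pow_ne_zero 3 (mul_ne_zero h₁ h₂)
  fun_prop (disch := assumption)

theorem trapezoidIntegral_sinSinhKernel_of_one_pole {a : ℕ} (ha : 2 ≤ a) {n : ℕ} (hn : 1 ≤ n)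
    {α β : ℝ} (hα : 0 < α) (h₁ : (n - 1) * π < α) (h₂ : α < n * π) (h₃ : n * π < β)
    (h₄ : β < (n + 1) * π) :
    trapezoidIntegral (sinSinhKernel a) α β =
      2 * π * Complex.I * ((-1) ^ n * residueDensity a (n * π)) := by
  set p : ℂ := ((n * π : ℝ) : ℂ) with hp
  have hp' : p = n * π := by simp [hp]
  set S : Set ℂ := {z : ℂ | (n - 1) * π < z.re} ∩ {z : ℂ | z.re < (n + 1) * π} with hS
  have hSopen : IsOpen S := (isOpen_lt (by fun_prop) (by fun_prop)).inter
    (isOpen_lt (by fun_prop) (by fun_prop))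
  have hSconv : Convex ℝ S := (convex_halfSpace_re_gt _).inter (convex_halfSpace_re_lt _)
  have hpS : p ∈ S := ⟨by simpa [hp] using h₁.trans h₂, by simpa [hp] using h₃.trans h₄⟩
  have hSnhds : S ∈ nhds p := hSopen.mem_nhds hpS
  have hn' : (1 : ℝ) ≤ n := by exact_mod_cast hn
  have hSpos : ∀ z ∈ S, 0 < z.re := fun z hz =>
    (mul_nonneg (by linarith) pi_pos.le).trans_lt hz.1
  have hsinh : ∀ z ∈ S, Complex.sinh z ≠ 0 := fun z hz => complex_sinh_ne_zero (hSpos z hz)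
  have hsin : ∀ z ∈ S, z ≠ p → Complex.sin z ≠ 0 := fun z hz hzp =>
    complex_sin_ne_zero (n := n) (by simpa using hz.1) (by simpa using hz.2) (by simpa [hp'] using hzp)
  have hsinp : Complex.sin p = 0 := by rw [hp', Complex.sin_nat_mul_pi]
  have hcosp : Complex.cos p = (-1) ^ n := by
    rw [hp, ← Complex.ofReal_cos, Real.cos_nat_mul_pi]
    simp
  set s : ℂ → ℂ := dslope Complex.sin p with hs
  have hsp : s p = (-1) ^ n := by
    rw [hs, dslope_same, (Complex.hasDerivAt_sin p).deriv, hcosp]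
  have hsz : ∀ z, z ≠ p → s z = Complex.sin z / (z - p) := by
    intro z hz
    rw [hs, dslope_of_ne _ hz, slope_def_field, hsinp, sub_zero]
  have hs0 : ∀ z ∈ S, s z ≠ 0 := by
    intro z hz
    by_cases hzp : z = p
    · rw [hzp, hsp]
      exact pow_ne_zero _ (by simp)
    · rw [hsz z hzp]
      exact div_ne_zero (hsin z hz hzp) (sub_ne_zero.2 hzp)
  have hsd : DifferentiableOn ℂ s S :=
    (Complex.differentiableOn_dslope hSnhds).2 Complex.differentiable_sin.differentiableOn
  set H : ℂ → ℂ := fun z => residueDensity a z / s z with hH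
  have hHd : DifferentiableOn ℂ H S := DifferentiableOn.div
    (fun z hz => (differentiableAt_residueDensity a (hsinh z hz)).differentiableWithinAt) hsd hs0
  have hHp : H p = (-1) ^ n * residueDensity a (n * π) := by
    rw [hH]
    simp only
    rw [hsp, hp', div_eq_mul_inv, ← inv_pow, mul_comm]
    norm_num
  obtain ⟨Φ, hΦ⟩ := hSconv.exists_forall_hasDerivWithinAt
    ((Complex.differentiableOn_dslope hSnhds).2 hHd)
  rw [← hHp]
  refine trapezoidIntegral_eq_of_hasDerivAt (Ψ := kernelPotential a + Φ) (p := n * π)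
    hα h₁ h₂ h₃ h₄ ?_ ?_
  · intro z hz₁ hz₂ hzp
    have hz : z ∈ S := ⟨hz₁, hz₂⟩
    have hsub : z - p ≠ 0 := sub_ne_zero.2 hzp
    have hs' := hsin z hz hzp
    refine ((hasDerivAt_kernelPotential ha hs' (hsinh z hz)).add
      ((hΦ z hz).hasDerivAt (hSopen.mem_nhds hz))).congr_deriv ?_
    rw [dslope_of_ne _ hzp, slope_def_field]
    have : H z = residueDensity a z * (z - p) / Complex.sin z := by
      simp only [hH]
      rw [hsz z hzp]
      field_simp
    rw [this]
    field_simp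
    ring
  · intro z hz
    exact (continuousAt_sinSinhKernel a (hsin z ⟨hz.1, hz.2.1⟩ hz.2.2)
      (hsinh z ⟨hz.1, hz.2.1⟩)).continuousWithinAt

theorem complex_sin_ne_zero_of_im_ne_zero {z : ℂ} (hz : z.im ≠ 0) : Complex.sin z ≠ 0 := by
  intro h
  obtain ⟨k, rfl⟩ := Complex.sin_eq_zero_iff.1 h
  apply hz
  simp

theorem continuousOn_sinSinhKernel_ray (a : ℕ) {v : ℂ} (hre : v.re = 1) (him : v.im ≠ 0)
    {α β : ℝ} (hα : 0 < α) :
    ContinuousOn (fun t : ℝ => sinSinhKernel a (t * v)) (Set.Icc α β) := by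
  intro t ht
  have ht0 : 0 < t := hα.trans_le ht.1
  have h : ContinuousAt (sinSinhKernel a) (t * v) :=
    continuousAt_sinSinhKernel a (complex_sin_ne_zero_of_im_ne_zero (by simp [him, ht0.ne']))
      (complex_sinh_ne_zero (by simp [hre, ht0]))
  exact (ContinuousAt.comp (f := fun t : ℝ => (t : ℂ) * v) h (by fun_prop)).continuousWithinAt

theorem trapezoidIntegral_sinSinhKernel {a : ℕ} (ha : 2 ≤ a) {ε : ℝ} (hε : 0 < ε) (hεπ : ε < π)
    (N : ℕ) :
    trapezoidIntegral (sinSinhKernel a) ε ((N + 3 / 2) * π) =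
      2 * π * Complex.I * ∑ n ∈ Finset.range (N + 1),
        (-1) ^ (n + 1) * residueDensity a ((n + 1 : ℕ) * π) := by
  have hπ := pi_pos
  induction N with
  | zero =>
    rw [trapezoidIntegral_sinSinhKernel_of_one_pole ha le_rfl hε]
    · simp
    all_goals push_cast; linarith
  | succ N ih =>
    have hN : (0 : ℝ) ≤ N * π := by positivity
    have hlt : ε ≤ (N + 3 / 2) * π := by linarith
    have hlt' : ((N : ℝ) + 3 / 2) * π ≤ ((N + 1 : ℕ) + 3 / 2) * π := by push_cast; linarith
    rw [Finset.sum_range_succ, mul_add, ← ih, ← trapezoidIntegral_add hlt hlt'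
      (continuousOn_sinSinhKernel_ray a (by simp) (by simp) hε)
      (continuousOn_sinSinhKernel_ray a (by simp) (by simp) hε),
      trapezoidIntegral_sinSinhKernel_of_one_pole (n := N + 1 + 1)
        (α := (N + 3 / 2) * π) ha (by omega)]
    all_goals push_cast; linarith

theorem exp_div_four_le_sinh {x : ℝ} (hx : 1 ≤ x) : Real.exp x / 4 ≤ Real.sinh x := by
  rw [Real.sinh_eq]
  have h₁ : Real.exp (-x) ≤ 1 := Real.exp_le_one_iff.2 (by linarith)
  have h₂ := Real.add_one_le_exp x
  linarith

theorem mul_exp_le_sinh (y : ℝ) : y * Real.exp y ≤ (1 + 2 * y) * Real.sinh y := by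
  have h := Real.add_one_le_exp (2 * y)
  have h2 : Real.exp (2 * y) = Real.exp y * Real.exp y := by rw [← Real.exp_add]; ring_nf
  have h3 : Real.exp (-y) * Real.exp y = 1 := by rw [← Real.exp_add]; simp
  have h4 : Real.exp (-y) * (2 * y + 1) ≤ Real.exp y := by
    calc _ ≤ Real.exp (-y) * Real.exp (2 * y) := by gcongr
      _ = Real.exp y := by rw [h2, ← mul_assoc, h3, one_mul]
  rw [Real.sinh_eq]
  linarith

theorem sq_mul_exp_le_cosh_sub_cos {x : ℝ} (hx : 0 ≤ x) :
    x ^ 2 * Real.exp x ≤ 2 * (1 + x) ^ 2 * (Real.cosh x - Real.cos x) := by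
  have h := mul_exp_le_sinh (x / 2)
  have h2 : Real.exp x = Real.exp (x / 2) ^ 2 := by rw [← Real.exp_nat_mul]; push_cast; ring_nf
  have h3 : Real.cosh x = 1 + 2 * Real.sinh (x / 2) ^ 2 := by
    have := Real.cosh_two_mul (x / 2)
    rw [Real.cosh_sq, mul_div_cancel₀ x two_ne_zero] at this
    linarith
  have h4 : (x / 2 * Real.exp (x / 2)) ^ 2 ≤ ((1 + 2 * (x / 2)) * Real.sinh (x / 2)) ^ 2 := by
    gcongr
  have h5 : (1 + x) ^ 2 * (2 * Real.sinh (x / 2) ^ 2) ≤ (1 + x) ^ 2 * (Real.cosh x - Real.cos x) := by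
    have := Real.cos_le_one x
    gcongr
    linarith
  rw [h2]
  nlinarith

theorem integrableOn_pow_div_cos_sub_cosh {a : ℕ} (ha : 6 ≤ a) :
    MeasureTheory.IntegrableOn (fun x : ℝ => x ^ a / (Real.cos x - Real.cosh x) ^ 3)
      (Set.Ioi 0) := by
  have hg : MeasureTheory.IntegrableOn
      (fun x : ℝ => 8 * a.factorial * Real.exp 1 * Real.exp (-2 * x)) (Set.Ioi 0) :=
    (integrableOn_exp_mul_Ioi (by norm_num) 0).const_mul _
  refine MeasureTheory.Integrable.mono' hg
    (Measurable.aestronglyMeasurable (by fun_prop)) ?_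
  refine (MeasureTheory.ae_restrict_iff' measurableSet_Ioi).2 (Filter.Eventually.of_forall ?_)
  intro x hx
  have hx : 0 < x := hx
  set D := Real.cosh x - Real.cos x with hD
  have h := sq_mul_exp_le_cosh_sub_cos hx.le
  have hDpos : 0 < D := by
    have h1 : 0 < x ^ 2 * Real.exp x := by positivity
    have h2 : 0 < 2 * (1 + x) ^ 2 := by positivity
    exact (mul_pos_iff_of_pos_left h2).1 (h1.trans_le h)
  have h3 : (x ^ 2 * Real.exp x) ^ 3 ≤ (2 * (1 + x) ^ 2 * D) ^ 3 := by gcongr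
  have h4 : (1 + x) ^ a ≤ a.factorial * (Real.exp 1 * Real.exp x) := by
    have := Real.pow_div_factorial_le_exp (1 + x) (by positivity) a
    rw [div_le_iff₀ (by positivity), Real.exp_add] at this
    linarith
  have h5 : x ^ (a - 6) * (1 + x) ^ 6 ≤ (1 + x) ^ a := by
    calc x ^ (a - 6) * (1 + x) ^ 6 ≤ (1 + x) ^ (a - 6) * (1 + x) ^ 6 := by gcongr; linarith
      _ = (1 + x) ^ a := by rw [← pow_add, Nat.sub_add_cancel ha]
  have hxa : x ^ a = x ^ (a - 6) * x ^ 6 := by rw [← pow_add, Nat.sub_add_cancel ha]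
  have he : Real.exp (-2 * x) * Real.exp x ^ 3 = Real.exp x := by
    rw [← Real.exp_nat_mul, ← Real.exp_add]; push_cast; ring_nf
  have hneg : Real.cos x - Real.cosh x = -D := by rw [hD]; ring
  rw [hneg, norm_div, norm_pow, norm_pow, norm_neg, Real.norm_of_nonneg hx.le,
    Real.norm_of_nonneg hDpos.le, div_le_iff₀ (by positivity)]
  refine le_of_mul_le_mul_right ?_ (show 0 < Real.exp x ^ 3 by positivity)
  calc x ^ a * Real.exp x ^ 3 = x ^ (a - 6) * (x ^ 2 * Real.exp x) ^ 3 := by rw [hxa]; ring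
    _ ≤ x ^ (a - 6) * (2 * (1 + x) ^ 2 * D) ^ 3 := by gcongr
    _ = 8 * (x ^ (a - 6) * (1 + x) ^ 6) * D ^ 3 := by ring
    _ ≤ 8 * (a.factorial * (Real.exp 1 * Real.exp x)) * D ^ 3 := by
      exact mul_le_mul_of_nonneg_right
        (mul_le_mul_of_nonneg_left (h5.trans h4) (by norm_num)) (by positivity)
    _ = 8 * a.factorial * Real.exp 1 * Real.exp (-2 * x) * D ^ 3 * Real.exp x ^ 3 := by
      linear_combination (-8 * a.factorial * Real.exp 1 * D ^ 3) * he

open Filter Topology in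
theorem tendsto_intervalIntegral_of_integrableOn_Ioi {f : ℝ → ℝ}
    (hf : MeasureTheory.IntegrableOn f (Set.Ioi 0)) {ε R : ℕ → ℝ} (hε : ∀ n, 0 < ε n)
    (hεR : ∀ n, ε n ≤ R n) (hε0 : Tendsto ε atTop (𝓝 0)) (hR : Tendsto R atTop atTop) :
    Tendsto (fun n => ∫ t in (ε n)..(R n), f t) atTop (𝓝 (∫ t in Set.Ioi 0, f t)) := by
  have hcover : MeasureTheory.AECover (MeasureTheory.volume.restrict (Set.Ioi (0 : ℝ))) atTop
      fun n => Set.Ioi (ε n) ∩ Set.Iic (R n) :=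
    (MeasureTheory.aecover_Ioi_of_Ioi hε0).inter (MeasureTheory.aecover_Iic hR)
  refine (hcover.integral_tendsto_of_countably_generated hf).congr fun n => ?_
  rw [intervalIntegral.integral_of_le (hεR n), Set.Ioi_inter_Iic,
    MeasureTheory.Measure.restrict_restrict measurableSet_Ioc, Set.inter_eq_left.2]
  exact fun t ht => (hε n).trans ht.1

theorem norm_sinSinhKernel_le {a : ℕ} {x y m : ℝ} (hx : 0 < x) (hy : |y| ≤ x) (hm : 0 < m)
    (h : m ≤ |Real.sin x| * Real.sinh x) :
    ‖sinSinhKernel a (x + y * Complex.I)‖ ≤ (2 * x) ^ a / m ^ 3 := by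
  have h₁ := abs_sin_re_le_norm_sin (x + y * Complex.I)
  have h₂ := sinh_re_le_norm_sinh (x + y * Complex.I)
  have hre : ((x : ℂ) + y * Complex.I).re = x := by simp
  rw [hre] at h₁ h₂
  have h₃ : ‖(x : ℂ) + y * Complex.I‖ ≤ 2 * x := by
    refine (norm_add_le _ _).trans ?_
    simp only [Complex.norm_real, norm_mul, Complex.norm_I, mul_one, Real.norm_eq_abs]
    rw [abs_of_pos hx]
    linarith
  have h₄ : m ≤ ‖Complex.sin (x + y * Complex.I) * Complex.sinh (x + y * Complex.I)‖ := by
    rw [norm_mul]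
    refine h.trans (mul_le_mul h₁ h₂ (Real.sinh_pos_iff.2 hx).le (norm_nonneg _))
  rw [sinSinhKernel, norm_div, norm_pow, norm_pow]
  gcongr

theorem norm_integral_vertical_sinSinhKernel_le {a : ℕ} {x m : ℝ} (hx : 0 < x) (hm : 0 < m)
    (h : m ≤ |Real.sin x| * Real.sinh x) :
    ‖∫ y in (-x)..x, sinSinhKernel a (x + y * Complex.I) * Complex.I‖ ≤
      (2 * x) ^ (a + 1) / m ^ 3 := by
  refine (intervalIntegral.norm_integral_le_of_norm_le_const (C := (2 * x) ^ a / m ^ 3) ?_).trans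
    (le_of_eq ?_)
  · intro y hy
    rw [Set.uIoc_of_le (by linarith)] at hy
    rw [norm_mul, Complex.norm_I, mul_one]
    exact norm_sinSinhKernel_le hx (abs_le.2 ⟨hy.1.le, hy.2⟩) hm h
  · rw [sub_neg_eq_add, abs_of_pos (by linarith)]
    ring

open Filter Topology in
theorem tendsto_integral_vertical_sinSinhKernel_zero {a : ℕ} (ha : 6 ≤ a) {ε : ℕ → ℝ}
    (hε : ∀ n, 0 < ε n) (hε₁ : ∀ n, ε n ≤ 1) (hε0 : Tendsto ε atTop (𝓝 0)) :
    Tendsto (fun n => ∫ y in (-ε n)..(ε n), sinSinhKernel a (ε n + y * Complex.I) * Complex.I)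
      atTop (𝓝 0) := by
  have hlim : Tendsto (fun n => 2 ^ (a + 1) * (π / 2) ^ 3 * ε n) atTop (𝓝 0) := by
    simpa using hε0.const_mul (2 ^ (a + 1) * (π / 2) ^ 3)
  refine squeeze_zero_norm (fun n => ?_) hlim
  have hx := hε n
  have hx1 := hε₁ n
  generalize ε n = x at hx hx1 ⊢
  have hπ := pi_gt_three
  refine (norm_integral_vertical_sinSinhKernel_le (m := 2 / π * x * x) hx (by positivity)
    ?_).trans ?_
  · have h1 := Real.mul_le_sin hx.le (by linarith)
    exact mul_le_mul (h1.trans (le_abs_self _)) (Real.self_le_sinh_iff.2 hx.le) hx.le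
      (abs_nonneg _)
  · have h7 : x ^ (a + 1) ≤ x ^ 7 := pow_le_pow_of_le_one hx.le hx1 (by omega)
    calc (2 * x) ^ (a + 1) / (2 / π * x * x) ^ 3
        = 2 ^ (a + 1) * (π / 2) ^ 3 * (x ^ (a + 1) / x ^ 6) := by
          rw [mul_pow]
          field_simp
      _ ≤ 2 ^ (a + 1) * (π / 2) ^ 3 * (x ^ 7 / x ^ 6) := by gcongr
      _ = 2 ^ (a + 1) * (π / 2) ^ 3 * x := by
          field_simp

theorem abs_sin_half_odd_mul_pi (N : ℕ) : |Real.sin ((N + 3 / 2) * π)| = 1 := by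
  have hc : Real.cos ((N + 3 / 2) * π) = 0 :=
    Real.cos_eq_zero_iff.2 ⟨N + 1, by push_cast; ring⟩
  have h := Real.sin_sq_add_cos_sq ((N + 3 / 2) * π)
  rw [hc] at h
  rw [← sq_eq_sq₀ (abs_nonneg _) zero_le_one, sq_abs]
  linarith

open Filter Topology in
theorem tendsto_integral_vertical_sinSinhKernel_atTop (a : ℕ) :
    Tendsto (fun N : ℕ => ∫ y in (-((N + 3 / 2) * π))..((N + 3 / 2) * π),
      sinSinhKernel a (((N + 3 / 2) * π : ℝ) + y * Complex.I) * Complex.I) atTop (𝓝 0) := by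
  have hR : Tendsto (fun N : ℕ => ((N : ℝ) + 3 / 2) * π) atTop atTop :=
    (tendsto_atTop_add_const_right _ _ tendsto_natCast_atTop_atTop).atTop_mul_const pi_pos
  have hlim : Tendsto (fun N : ℕ => 64 * 2 ^ (a + 1) *
      ((((N : ℝ) + 3 / 2) * π) ^ (a + 1) * Real.exp (-(((N : ℝ) + 3 / 2) * π)))) atTop (𝓝 0) := by
    simpa using ((Real.tendsto_pow_mul_exp_neg_atTop_nhds_zero (a + 1)).comp hR).const_mul
      (64 * 2 ^ (a + 1))
  refine squeeze_zero_norm (fun N => ?_) hlim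
  have hs := abs_sin_half_odd_mul_pi N
  have hx1 : 1 ≤ ((N : ℝ) + 3 / 2) * π := by
    have := pi_gt_three
    have hN : (0 : ℝ) ≤ N * π := by positivity
    linarith
  generalize ((N : ℝ) + 3 / 2) * π = x at hs hx1 ⊢
  have hx : 0 < x := by linarith
  refine (norm_integral_vertical_sinSinhKernel_le (m := Real.exp x / 4) hx (by positivity)
    ?_).trans ?_
  · rw [hs, one_mul]
    exact exp_div_four_le_sinh hx1
  · have h1 : Real.exp (-x) = (Real.exp x)⁻¹ := Real.exp_neg x
    have h2 : Real.exp x ≤ Real.exp x ^ 3 := le_self_pow₀ (Real.one_le_exp hx.le) (by norm_num)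
    calc (2 * x) ^ (a + 1) / (Real.exp x / 4) ^ 3
        = 64 * 2 ^ (a + 1) * (x ^ (a + 1) / Real.exp x ^ 3) := by
          rw [mul_pow]
          field_simp
          norm_num
      _ ≤ 64 * 2 ^ (a + 1) * (x ^ (a + 1) / Real.exp x) := by gcongr
      _ = 64 * 2 ^ (a + 1) * (x ^ (a + 1) * Real.exp (-x)) := by rw [h1, div_eq_mul_inv]

open Complex in
theorem sinSinhKernel_lower_ray (a : ℕ) (t : ℝ) :
    sinSinhKernel a (t * (1 - I)) * (1 - I) = 8 * I * (1 - I) ^ (a + 1) / 2 ^ a *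
      (((2 * t) ^ a / (Real.cos (2 * t) - Real.cosh (2 * t)) ^ 3 : ℝ) : ℂ) := by
  have h1 : Complex.cos (2 * t) - Complex.cosh (2 * t) =
      -2 * I * (Complex.sin (t * (1 - I)) * Complex.sinh (t * (1 - I))) := by
    rw [← Complex.cos_mul_I, Complex.cos_sub_cos,
      show (2 * t + 2 * t * I) / 2 = (t * (1 - I)) * I by linear_combination (t : ℂ) * I_sq,
      show (2 * t - 2 * t * I) / 2 = t * (1 - I) by ring, Complex.sin_mul_I]
    ring
  push_cast
  rw [h1, sinSinhKernel]
  have h2 : (-2 * I) ^ 3 = 8 * I := by linear_combination (-8 * I) * I_sq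
  rw [mul_pow (-2 * I), h2, mul_pow (2 : ℂ), mul_pow (t : ℂ)]
  field_simp
  ring

open Complex in
theorem sinSinhKernel_upper_ray (a : ℕ) (t : ℝ) :
    sinSinhKernel a (t * (1 + I)) * (1 + I) = -(8 * I * (1 + I) ^ (a + 1) / 2 ^ a) *
      (((2 * t) ^ a / (Real.cos (2 * t) - Real.cosh (2 * t)) ^ 3 : ℝ) : ℂ) := by
  have h1 : Complex.cos (2 * t) - Complex.cosh (2 * t) =
      2 * I * (Complex.sin (t * (1 + I)) * Complex.sinh (t * (1 + I))) := by
    rw [← Complex.cos_mul_I, Complex.cos_sub_cos,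
      show (2 * t - 2 * t * I) / 2 = -((t * (1 + I)) * I) by linear_combination (t : ℂ) * I_sq,
      show (2 * t + 2 * t * I) / 2 = t * (1 + I) by ring, Complex.sin_neg, Complex.sin_mul_I]
    ring
  push_cast
  rw [h1, sinSinhKernel]
  have h2 : (2 * I) ^ 3 = -(8 * I) := by linear_combination (8 * I) * I_sq
  rw [mul_pow (2 * I), h2, mul_pow (2 : ℂ), mul_pow (t : ℂ)]
  field_simp
  ring

open Complex in
theorem trapezoidIntegral_sinSinhKernel_eq_real (a : ℕ) (α β : ℝ) :
    trapezoidIntegral (sinSinhKernel a) α β =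
      8 * I / 2 ^ a * ((1 - I) ^ (a + 1) + (1 + I) ^ (a + 1)) *
        ((∫ t in α..β, (2 * t) ^ a / (Real.cos (2 * t) - Real.cosh (2 * t)) ^ 3 : ℝ) : ℂ)
      + (∫ y in (-β)..β, sinSinhKernel a (β + y * I) * I)
      - ∫ y in (-α)..α, sinSinhKernel a (α + y * I) * I := by
  simp only [trapezoidIntegral, sinSinhKernel_lower_ray, sinSinhKernel_upper_ray]
  rw [intervalIntegral.integral_const_mul, intervalIntegral.integral_const_mul,
    intervalIntegral.integral_ofReal]
  ring

open Filter Topology Complex in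
theorem tendsto_sum_residueDensity {a : ℕ} (ha : 6 ≤ a) :
    Tendsto (fun N : ℕ => 2 * π * I * ∑ n ∈ Finset.range (N + 1),
        (-1) ^ (n + 1) * residueDensity a ((n + 1 : ℕ) * π)) atTop
      (𝓝 (4 * I / 2 ^ a * ((1 - I) ^ (a + 1) + (1 + I) ^ (a + 1)) *
        ((∫ x in Set.Ioi (0 : ℝ), x ^ a / (Real.cos x - Real.cosh x) ^ 3 : ℝ) : ℂ))) := by
  set f : ℝ → ℝ := fun x => x ^ a / (Real.cos x - Real.cosh x) ^ 3 with hf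
  have hfi : MeasureTheory.IntegrableOn f (Set.Ioi 0) := integrableOn_pow_div_cos_sub_cosh ha
  have hfi2 : MeasureTheory.IntegrableOn (fun t => f (2 * t)) (Set.Ioi 0) := by
    have := MeasureTheory.integrableOn_Ioi_comp_mul_left_iff f 0 (zero_lt_two' ℝ)
    rw [mul_zero] at this
    exact this.2 hfi
  have hint : ∫ t in Set.Ioi (0 : ℝ), f (2 * t) = 2⁻¹ * ∫ x in Set.Ioi (0 : ℝ), f x := by
    simpa using MeasureTheory.integral_comp_mul_left_Ioi f 0 (zero_lt_two' ℝ)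
  have hε (n : ℕ) : 0 < 1 / ((n : ℝ) + 1) := Nat.one_div_pos_of_nat
  have hε₁ (n : ℕ) : 1 / ((n : ℝ) + 1) ≤ 1 := by
    rw [div_le_one (by positivity)]
    linarith [n.cast_nonneg (α := ℝ)]
  have hε0 := tendsto_one_div_add_atTop_nhds_zero_nat (𝕜 := ℝ)
  have hR : Tendsto (fun N : ℕ => ((N : ℝ) + 3 / 2) * π) atTop atTop :=
    (tendsto_atTop_add_const_right _ _ tendsto_natCast_atTop_atTop).atTop_mul_const pi_pos
  have hπ := pi_gt_three
  have hεR (n : ℕ) : 1 / ((n : ℝ) + 1) ≤ ((n : ℝ) + 3 / 2) * π := by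
    have hn : (0 : ℝ) ≤ n * π := by positivity
    linarith [hε₁ n]
  have hlim := tendsto_intervalIntegral_of_integrableOn_Ioi hfi2 hε hεR hε0 hR
  rw [hint] at hlim
  have hlimC := (continuous_ofReal.tendsto _).comp hlim
  have h := ((hlimC.const_mul (8 * I / 2 ^ a * ((1 - I) ^ (a + 1) + (1 + I) ^ (a + 1)))).add
    (tendsto_integral_vertical_sinSinhKernel_atTop a)).sub
    (tendsto_integral_vertical_sinSinhKernel_zero ha hε hε₁ hε0)
  have hval : 8 * I / 2 ^ a * ((1 - I) ^ (a + 1) + (1 + I) ^ (a + 1)) *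
      ((2⁻¹ * ∫ x in Set.Ioi (0 : ℝ), f x : ℝ) : ℂ) + 0 - 0 =
      4 * I / 2 ^ a * ((1 - I) ^ (a + 1) + (1 + I) ^ (a + 1)) *
        ((∫ x in Set.Ioi (0 : ℝ), f x : ℝ) : ℂ) := by
    push_cast
    ring
  rw [hval] at h
  refine h.congr fun N => ?_
  rw [← trapezoidIntegral_sinSinhKernel (by omega) (hε N) (by linarith [hε₁ N]),
    trapezoidIntegral_sinSinhKernel_eq_real]
  simp only [Function.comp_apply, hf]

theorem summable_of_le_pow_div_sinh {u : ℕ → ℝ} (k : ℕ) (C : ℝ)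
    (hu : ∀ n : ℕ, |u n| ≤ C * ((n : ℝ) + 1) ^ k / Real.sinh (((n : ℝ) + 1) * π)) :
    Summable u := by
  have hs : Summable fun n : ℕ => |C| * 4 * (((n : ℝ) + 1) ^ k * Real.exp (-1 * ((n : ℝ) + 1))) := by
    have := (summable_nat_add_iff 1).2 (Real.summable_pow_mul_exp_neg_nat_mul k one_pos)
    push_cast at this
    exact this.mul_left _
  refine Summable.of_norm_bounded hs fun n => ?_
  have hx : (1 : ℝ) ≤ (n : ℝ) + 1 := by linarith [n.cast_nonneg (α := ℝ)]
  rw [Real.norm_eq_abs]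
  refine (hu n).trans ?_
  generalize (n : ℝ) + 1 = x at hx ⊢
  have hx0 : 0 < x := by linarith
  have hxπ : x ≤ x * π := le_mul_of_one_le_right hx0.le (by linarith [pi_gt_three])
  have h1 : Real.exp x / 4 ≤ Real.sinh (x * π) :=
    (exp_div_four_le_sinh hx).trans (Real.sinh_le_sinh.2 hxπ)
  calc C * x ^ k / Real.sinh (x * π) ≤ |C| * x ^ k / (Real.exp x / 4) := by
        gcongr
        exact le_abs_self C
    _ = |C| * 4 * (x ^ k * Real.exp (-1 * x)) := by
        rw [neg_one_mul, Real.exp_neg]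
        field_simp

theorem one_le_sinh_add_one_mul_pi (n : ℕ) : 1 ≤ Real.sinh (((n : ℝ) + 1) * π) := by
  have h : (1 : ℝ) ≤ ((n : ℝ) + 1) * π := by
    have hn : (0 : ℝ) ≤ n * π := by positivity
    linarith [pi_gt_three]
  exact h.trans (Real.self_le_sinh_iff.2 (by linarith))

theorem summable_pow_div_sinh_pow (k : ℕ) {m : ℕ} (hm : 1 ≤ m) :
    Summable fun n : ℕ => (-1 : ℝ) ^ (n + 1) * ((n : ℝ) + 1) ^ k
      / Real.sinh (((n : ℝ) + 1) * π) ^ m := by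
  refine summable_of_le_pow_div_sinh k 1 fun n => ?_
  have h := one_le_sinh_add_one_mul_pi n
  generalize Real.sinh (((n : ℝ) + 1) * π) = s at h ⊢
  have hs : s ≤ s ^ m := le_self_pow₀ h (by omega)
  rw [abs_div, abs_mul, abs_neg_one_pow, abs_of_pos (show 0 < ((n : ℝ) + 1) ^ k by positivity),
    abs_of_pos (show 0 < s ^ m by positivity)]
  gcongr

theorem summable_pow_mul_cosh_div_sinh_pow (k : ℕ) {m : ℕ} (hm : 2 ≤ m) :
    Summable fun n : ℕ => (-1 : ℝ) ^ (n + 1) * ((n : ℝ) + 1) ^ k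
      * Real.cosh (((n : ℝ) + 1) * π) / Real.sinh (((n : ℝ) + 1) * π) ^ m := by
  refine summable_of_le_pow_div_sinh k 2 fun n => ?_
  have h := one_le_sinh_add_one_mul_pi n
  have hc : Real.cosh (((n : ℝ) + 1) * π) ≤ 2 * Real.sinh (((n : ℝ) + 1) * π) := by
    have h1 := Real.cosh_sub_sinh (((n : ℝ) + 1) * π)
    have h2 : Real.exp (-(((n : ℝ) + 1) * π)) ≤ 1 :=
      Real.exp_le_one_iff.2 (neg_nonpos.2 (by positivity))
    linarith
  have hcpos := Real.cosh_pos (((n : ℝ) + 1) * π)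
  generalize Real.sinh (((n : ℝ) + 1) * π) = s at h hc ⊢
  generalize Real.cosh (((n : ℝ) + 1) * π) = c at hc hcpos ⊢
  have hs : s ^ 2 ≤ s ^ m := pow_le_pow_right₀ h hm
  have hx : 0 < ((n : ℝ) + 1) ^ k := by positivity
  rw [abs_div, abs_mul, abs_mul, abs_neg_one_pow, abs_of_pos hx, abs_of_pos hcpos,
    abs_of_pos (show 0 < s ^ m by positivity), one_mul]
  calc ((n : ℝ) + 1) ^ k * c / s ^ m ≤ ((n : ℝ) + 1) ^ k * (2 * s) / s ^ 2 := by gcongr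
    _ = 2 * ((n : ℝ) + 1) ^ k / s := by field_simp

theorem neg_one_pow_mul_residueDensity (a n : ℕ) :
    (-1) ^ (n + 1) * residueDensity a ((n + 1 : ℕ) * π) =
      (a : ℂ) * (a - 1) / 2 * (π : ℂ) ^ (a - 2) *
        (((-1 : ℝ) ^ (n + 1) * ((n : ℝ) + 1) ^ (a - 2)
          / Real.sinh (((n : ℝ) + 1) * π) ^ 3 : ℝ) : ℂ)
      - 3 * a * (π : ℂ) ^ (a - 1) *
        (((-1 : ℝ) ^ (n + 1) * ((n : ℝ) + 1) ^ (a - 1)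
          * Real.cosh (((n : ℝ) + 1) * π) / Real.sinh (((n : ℝ) + 1) * π) ^ 4 : ℝ) : ℂ)
      + 5 * (π : ℂ) ^ a *
        (((-1 : ℝ) ^ (n + 1) * ((n : ℝ) + 1) ^ a
          / Real.sinh (((n : ℝ) + 1) * π) ^ 3 : ℝ) : ℂ)
      + 6 * (π : ℂ) ^ a *
        (((-1 : ℝ) ^ (n + 1) * ((n : ℝ) + 1) ^ a
          / Real.sinh (((n : ℝ) + 1) * π) ^ 5 : ℝ) : ℂ) := by
  rw [residueDensity]
  push_cast
  simp only [mul_pow]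
  ring

open Complex in
theorem one_sub_I_pow_add_one_add_I_pow (a : ℕ) (ha : 3 ≤ a) :
    (1 - I) ^ (a + 1) + (1 + I) ^ (a + 1) =
      -(2 ^ a / 2) * ((1 + I ^ (a + 1)) / (1 + I) ^ (a - 3)) := by
  have h0 : (1 : ℂ) + I ≠ 0 := by
    intro h
    simpa using congrArg Complex.re h
  have h1 : (1 : ℂ) - I = 2 / (1 + I) := by
    rw [eq_div_iff h0]
    linear_combination -I_sq
  have h2 : (1 : ℂ) + I = I * (2 / (1 + I)) := by
    rw [← h1]
    linear_combination I_sq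
  have h4 : ((1 : ℂ) + I) ^ 4 = -4 := by
    linear_combination (I ^ 2 + 4 * I + 5) * I_sq
  have h5 : ((1 : ℂ) + I) ^ (a + 1) = (1 + I) ^ (a - 3) * -4 := by
    rw [← h4, ← pow_add]
    congr 1
    omega
  have h6 : ((1 : ℂ) + I) ^ (a + 1) = I ^ (a + 1) * (2 / (1 + I)) ^ (a + 1) := by
    rw [← mul_pow, ← h2]
  rw [h6, h1, div_pow, h5]
  field_simp
  ring
theorem contour_relation_cos_minus_cosh (a : ℕ) (ha : 6 ≤ a) :
    ((1 + Complex.I ^ (a+1)) / ((π : ℂ) ^ (a - 1) * (1 + Complex.I) ^ (a - 3))) *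
      ((∫ x in Set.Ioi (0:ℝ), x ^ a / (Real.cos x - Real.cosh x) ^ 3 : ℝ) : ℂ) =
    -((a : ℂ) * ((a : ℂ) - 1) / 2) *
        ((∑' n : ℕ, (-1 : ℝ) ^ (n+1) * ((n:ℝ)+1) ^ (a - 2)
            / Real.sinh (((n:ℝ)+1) * π) ^ 3 : ℝ) : ℂ)
    + 3 * (a : ℂ) * (π : ℂ) *
        ((∑' n : ℕ, (-1 : ℝ) ^ (n+1) * ((n:ℝ)+1) ^ (a - 1)
            * Real.cosh (((n:ℝ)+1) * π) / Real.sinh (((n:ℝ)+1) * π) ^ 4 : ℝ) : ℂ)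
    - 5 * (π : ℂ) ^ 2 *
        ((∑' n : ℕ, (-1 : ℝ) ^ (n+1) * ((n:ℝ)+1) ^ a
            / Real.sinh (((n:ℝ)+1) * π) ^ 3 : ℝ) : ℂ)
    - 6 * (π : ℂ) ^ 2 *
        ((∑' n : ℕ, (-1 : ℝ) ^ (n+1) * ((n:ℝ)+1) ^ a
            / Real.sinh (((n:ℝ)+1) * π) ^ 5 : ℝ) : ℂ) := by
  obtain ⟨s₁, h₁⟩ := summable_pow_div_sinh_pow (a - 2) (m := 3) (by norm_num)
  obtain ⟨s₂, h₂⟩ := summable_pow_mul_cosh_div_sinh_pow (a - 1) (m := 4) (by norm_num)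
  obtain ⟨s₃, h₃⟩ := summable_pow_div_sinh_pow a (m := 3) (by norm_num)
  obtain ⟨s₄, h₄⟩ := summable_pow_div_sinh_pow a (m := 5) (by norm_num)
  rw [h₁.tsum_eq, h₂.tsum_eq, h₃.tsum_eq, h₄.tsum_eq]
  have hsum := ((((Complex.hasSum_ofReal.2 h₁).mul_left
    ((a : ℂ) * (a - 1) / 2 * (π : ℂ) ^ (a - 2))).sub
    ((Complex.hasSum_ofReal.2 h₂).mul_left (3 * a * (π : ℂ) ^ (a - 1)))).add
    ((Complex.hasSum_ofReal.2 h₃).mul_left (5 * (π : ℂ) ^ a))).add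
    ((Complex.hasSum_ofReal.2 h₄).mul_left (6 * (π : ℂ) ^ a))
  simp only [← neg_one_pow_mul_residueDensity] at hsum
  have hlim := tendsto_nhds_unique (tendsto_sum_residueDensity ha)
    ((((Filter.tendsto_add_atTop_iff_nat 1).2 hsum.tendsto_sum_nat)).const_mul
      (2 * π * Complex.I))
  rw [one_sub_I_pow_add_one_add_I_pow a (by omega)] at hlim
  generalize (∫ x in Set.Ioi (0 : ℝ), x ^ a / (Real.cos x - Real.cosh x) ^ 3 : ℝ) = J at hlim ⊢
  obtain ⟨b, rfl⟩ := Nat.exists_eq_add_of_le' (show 2 ≤ a by omega)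
  have e₁ : b + 2 - 1 = b + 1 := rfl
  have e₂ : b + 2 - 2 = b := rfl
  simp only [e₁, e₂] at hlim ⊢
  have hπ : (π : ℂ) ≠ 0 := Complex.ofReal_ne_zero.2 pi_ne_zero
  rw [mul_comm ((π : ℂ) ^ (b + 1)), ← div_div]
  generalize (1 + Complex.I ^ (b + 2 + 1)) / (1 + Complex.I) ^ (b + 2 - 3) = w at hlim ⊢
  have hI := Complex.I_ne_zero
  field_simp at hlim ⊢
  linear_combination (-1 / 2 : ℂ) * hlim
end

section
/- For every integer p ≥ 0: ((−4)^(p+1)/π^(4p)) · ∫_0^∞ x^(4p+1)/(cos x + cosh x)^3 dx = 4p(4p+1)·Σ_{n=1}^∞ (−1)^n (2n−1)^(4p−1)/cosh((2n−1)π/2)^3 + (5π²/2)·Σ_{n=1}^∞ (−1)^n (2n−1)^(4p+1)/cosh((2n−1)π/2)^3 − 3(4p+1)π·Σ_{n=1}^∞ (−1)^n (2n−1)^(4p) sinh((2n−1)π/2)/cosh((2n−1)π/2)^4 − 3π²·Σ_{n=1}^∞ (−1)^n (2n−1)^(4p+1)/cosh((2n−1)π/2)^5. -/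
open Real

open MeasureTheory Set Filter Topology Asymptotics

lemma exp_re_div_three_le_norm_cosh {w : ℂ} (h : |w.im| ≤ w.re) :
    Real.exp w.re / 3 ≤ ‖Complex.cosh w‖ := by
  obtain ⟨a, b⟩ := w
  simp only at h ⊢
  have ha : 0 ≤ a := (abs_nonneg b).trans h
  have hn : ‖Complex.cosh ⟨a, b⟩‖ ^ 2 = Real.cosh a ^ 2 - Real.sin b ^ 2 := by
    have : (⟨a, b⟩ : ℂ) = a + b * Complex.I := by apply Complex.ext <;> simp
    rw [this, Complex.cosh_add, Complex.cosh_mul_I, Complex.sinh_mul_I, ← Complex.ofReal_cosh,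
      ← Complex.ofReal_sinh, ← Complex.ofReal_cos, ← Complex.ofReal_sin, Complex.sq_norm,
      Complex.normSq_apply]
    simp only [Complex.add_re, Complex.add_im, Complex.mul_re, Complex.mul_im, Complex.ofReal_re,
      Complex.ofReal_im, Complex.I_re, Complex.I_im]
    nlinarith [Real.cosh_sq a, Real.sin_sq_add_cos_sq b]
  have hs1 : Real.sin b ^ 2 ≤ 1 := Real.sin_sq_le_one b
  have hs2 : Real.sin b ^ 2 ≤ a ^ 2 := by
    rw [sq_le_sq, abs_of_nonneg ha]
    exact Real.abs_sin_le_abs.trans h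
  have hE := Real.quadratic_le_exp_of_nonneg (x := 2 * a) (by linarith)
  have hE' := Real.add_one_le_exp (-(2 * a))
  have hE'' := Real.exp_pos (-(2 * a))
  have h1 : Real.exp a ^ 2 = Real.exp (2 * a) := by rw [← Real.exp_nat_mul]; norm_num
  have h2 : Real.cosh a ^ 2 = (Real.exp (2 * a) + 2 + Real.exp (-(2 * a))) / 4 := by
    have := Real.cosh_two_mul a
    have h3 := Real.cosh_sq a
    have h4 := Real.cosh_eq (2 * a)
    linarith
  refine le_of_sq_le_sq ?_ (norm_nonneg _)
  rw [hn, h2, div_pow, h1]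
  rcases le_total a 0.8 with h8 | h8 <;> nlinarith

lemma norm_le_two_mul_re {w : ℂ} (h : |w.im| ≤ w.re) : ‖w‖ ≤ 2 * w.re := by
  have := Complex.norm_le_abs_re_add_abs_im w
  rw [abs_of_nonneg ((abs_nonneg _).trans h)] at this
  linarith

lemma norm_sinh_le {w : ℂ} (h : 0 ≤ w.re) : ‖Complex.sinh w‖ ≤ ‖w‖ * Real.exp w.re := by
  have key := norm_image_sub_le_of_norm_deriv_le_segment_01' (f := fun t : ℝ => Complex.sinh (w * t))
    (f' := fun t : ℝ => Complex.cosh (w * t) * w) (C := ‖w‖ * Real.exp w.re) ?_ ?_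
  · simpa using key
  · intro x _
    have h1 : HasDerivAt (fun t : ℂ => Complex.sinh (w * t)) (Complex.cosh (w * x) * (w * 1)) (x : ℂ) :=
      ((hasDerivAt_id (x : ℂ)).const_mul w).csinh
    simpa using h1.comp_ofReal.hasDerivWithinAt
  · intro x hx
    have h1 : ‖Complex.cosh (w * x)‖ ≤ Real.exp w.re := by
      rw [Complex.cosh, norm_div]
      have h3 := norm_add_le (Complex.exp (w * x)) (Complex.exp (-(w * x)))
      rw [Complex.norm_exp, Complex.norm_exp] at h3
      have e1 : Real.exp (w * x).re ≤ Real.exp w.re := by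
        apply Real.exp_le_exp.2
        simp
        nlinarith [hx.1, hx.2]
      have e2 : Real.exp (-(w * x)).re ≤ Real.exp w.re := by
        apply Real.exp_le_exp.2
        simp
        nlinarith [hx.1, hx.2, mul_nonneg h hx.1]
      rw [Complex.norm_two]
      linarith
    rw [norm_mul, mul_comm]
    gcongr

lemma integrableOn_ray {G : ℂ → ℂ} {C : ℝ} (hd : DifferentiableOn ℂ G {w | 0 < w.re})
    (hb : ∀ w : ℂ, 0 < w.re → -w.re ≤ w.im → w.im ≤ 0 → ‖G w‖ ≤ C * ‖w‖ * Real.exp (-w.re))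
    {s : ℝ} (hs : s ∈ Icc (0 : ℝ) 1) :
    IntegrableOn (fun x : ℝ => G (x - Complex.I * (x * s))) (Ioi 0) := by
  have hint : IntegrableOn (fun x : ℝ => |C| * 2 * (x ^ (1 : ℝ) * Real.exp (-1 * x))) (Ioi 0) :=
    ((integrableOn_rpow_mul_exp_neg_mul_rpow (s := 1) (by norm_num) one_pos one_pos).congr_fun
      (fun x _ => by simp) measurableSet_Ioi).const_mul _
  refine hint.mono' ?_ ?_
  · apply ContinuousOn.aestronglyMeasurable _ measurableSet_Ioi
    refine hd.continuousOn.comp (by fun_prop) ?_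
    intro x hx
    simpa using hx
  · refine (ae_restrict_iff' measurableSet_Ioi).2 (Eventually.of_forall fun x hx => ?_)
    have hx : 0 < x := hx
    set w : ℂ := x - Complex.I * (x * s) with hw
    have hre : w.re = x := by simp [hw]
    have him : w.im = -(x * s) := by simp [hw]
    have h1 : -w.re ≤ w.im := by rw [hre, him]; nlinarith [hs.2]
    have h2 : w.im ≤ 0 := by rw [him]; nlinarith [hs.1]
    have h3 := hb w (by rwa [hre]) h1 h2
    have h4 : ‖w‖ ≤ 2 * w.re := norm_le_two_mul_re (abs_le.2 ⟨h1, by linarith⟩)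
    rw [hre] at h3 h4
    calc ‖G w‖ ≤ C * ‖w‖ * Real.exp (-x) := h3
      _ ≤ |C| * (2 * x) * Real.exp (-x) := by
        gcongr
        exact le_abs_self C
      _ = _ := by simp; ring

lemma integral_ray_eq {G : ℂ → ℂ} {C : ℝ} (hd : DifferentiableOn ℂ G {w | 0 < w.re})
    (hb : ∀ w : ℂ, 0 < w.re → -w.re ≤ w.im → w.im ≤ 0 → ‖G w‖ ≤ C * ‖w‖ * Real.exp (-w.re)) :
    ∫ x in Ioi (0 : ℝ), G ((1 - Complex.I) * x) * (1 - Complex.I) =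
      ∫ x in Ioi (0 : ℝ), G x := by
  have hi0 : IntegrableOn (fun x : ℝ => G x) (Ioi 0) := by
    simpa using integrableOn_ray hd hb (s := 0) (by simp)
  have hi1 : IntegrableOn (fun x : ℝ => G ((1 - Complex.I) * x) * (1 - Complex.I)) (Ioi 0) := by
    have h1 : IntegrableOn (fun x : ℝ => G (x - Complex.I * (x * (1 : ℝ))) * (1 - Complex.I)) (Ioi 0) :=
      (integrableOn_ray hd hb (s := 1) (by simp)).mul_const _
    refine h1.congr_fun (fun x _ => ?_) measurableSet_Ioi
    simp [sub_mul]
  set S : ℕ → Set ℝ := fun n => Ioc (1 / ((n : ℝ) + 1)) ((n : ℝ) + 1) with hS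
  have hSm : Monotone S := by
    intro m n hmn
    have : (m : ℝ) ≤ n := by exact_mod_cast hmn
    apply Ioc_subset_Ioc
    · gcongr
    · gcongr
  have hSU : ⋃ n, S n = Ioi 0 := by
    ext x
    simp only [hS, mem_iUnion, mem_Ioc, mem_Ioi]
    constructor
    · rintro ⟨n, h, -⟩
      exact lt_trans (by positivity) h
    · intro hx
      obtain ⟨n, hn⟩ := exists_nat_gt (max x (1 / x))
      refine ⟨n, ?_, ?_⟩
      · rw [div_lt_iff₀ (by positivity)]
        have h1 := (le_max_right x (1 / x)).trans_lt hn
        rw [div_lt_iff₀ hx] at h1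
        nlinarith
      · have h1 := (le_max_left x (1 / x)).trans_lt hn
        linarith
  have t1 := tendsto_setIntegral_of_monotone (μ := volume) (s := S)
    (f := fun x : ℝ => G ((1 - Complex.I) * x) * (1 - Complex.I))
    (fun _ => measurableSet_Ioc) hSm (by rwa [hSU])
  have t0 := tendsto_setIntegral_of_monotone (μ := volume) (s := S) (f := fun x : ℝ => G x)
    (fun _ => measurableSet_Ioc) hSm (by rwa [hSU])
  rw [hSU] at t0 t1
  set b : ℝ → ℝ := fun t => C * (2 * t) * Real.exp (-t) * t
  have key : ∀ n, ‖(∫ x in S n, G ((1 - Complex.I) * x) * (1 - Complex.I)) - ∫ x in S n, G x‖ ≤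
      b ((n : ℝ) + 1) + b (1 / ((n : ℝ) + 1)) := by
    intro n
    set R : ℝ := (n : ℝ) + 1
    set ε : ℝ := 1 / R
    have hR : 1 ≤ R := by simp [R]
    have hε : 0 < ε := by positivity
    have hεR : ε ≤ R := by
      simp only [ε]
      rw [div_le_iff₀ (by positivity)]
      nlinarith
    have hball : Metric.ball ((R + 1 : ℝ) : ℂ) (R + 1) ⊆ {w : ℂ | 0 < w.re} := by
      intro w hw
      rw [Metric.mem_ball, Complex.dist_eq] at hw
      have := (Complex.abs_re_le_norm _).trans_lt hw
      rw [abs_lt] at this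
      simp at this ⊢
      linarith [this.1]
    have hmem : ∀ t ∈ Icc ε R, ∀ s ∈ Icc (0 : ℝ) 1,
        (t - Complex.I * (t * s) : ℂ) ∈ Metric.ball ((R + 1 : ℝ) : ℂ) (R + 1) := by
      intro t ht s hs
      rw [Metric.mem_ball, Complex.dist_eq]
      refine lt_of_pow_lt_pow_left₀ 2 (by positivity) ?_
      rw [Complex.sq_norm, Complex.normSq_apply]
      simp
      have ht0 : 0 < t := hε.trans_le ht.1
      have : s * s ≤ 1 := by nlinarith [hs.1, hs.2]
      have h2 : t * s * (t * s) ≤ t * t := by nlinarith [mul_pos ht0 ht0]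
      nlinarith [ht.2]
    obtain ⟨Φ, hΦ⟩ := (hd.mono hball).isExactOn_ball
    have hray : ∀ s ∈ Icc (0 : ℝ) 1, (∫ x in ε..R, G (x - Complex.I * (x * s)) * (1 - Complex.I * s)) =
        Φ (R - Complex.I * (R * s)) - Φ (ε - Complex.I * (ε * s)) := by
      intro s hs
      rw [intervalIntegral.integral_eq_sub_of_hasDerivAt (f := fun x : ℝ => Φ (x - Complex.I * (x * s)))]
      · intro x hx
        rw [uIcc_of_le hεR] at hx
        have h1 := hΦ _ (hmem x hx s hs)
        have h2 : HasDerivAt (fun z : ℂ => z - Complex.I * (z * s)) (1 - Complex.I * (1 * s)) (x : ℂ) :=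
          (hasDerivAt_id _).sub (((hasDerivAt_id _).mul_const _).const_mul _)
        simpa using (h1.comp (x : ℂ) h2).comp_ofReal
      · apply ContinuousOn.intervalIntegrable
        rw [uIcc_of_le hεR]
        refine ContinuousOn.mul ?_ (by fun_prop)
        exact (hd.mono hball).continuousOn.comp (by fun_prop) fun x hx => hmem x hx s hs
    have hvert : ∀ t ∈ Icc ε R, ‖Φ (t - Complex.I * (t * (1 : ℝ))) - Φ (t - Complex.I * (t * (0 : ℝ)))‖ ≤ b t := by
      intro t ht
      have ht0 : 0 < t := hε.trans_le ht.1
      refine norm_image_sub_le_of_norm_deriv_le_segment_01'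
        (f := fun s : ℝ => Φ (t - Complex.I * (t * s)))
        (f' := fun s : ℝ => G (t - Complex.I * (t * s)) * (-(Complex.I * t))) ?_ ?_
      · intro s hs
        have h1 := hΦ _ (hmem t ht s hs)
        have h2 : HasDerivAt (fun z : ℂ => t - Complex.I * (t * z)) (-(Complex.I * (t * 1))) (s : ℂ) :=
          (((hasDerivAt_id _).const_mul _).const_mul _).const_sub _
        simpa using (h1.comp (s : ℂ) h2).comp_ofReal.hasDerivWithinAt
      · intro s hs
        set w : ℂ := t - Complex.I * (t * s) with hw
        have hre : w.re = t := by simp [hw]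
        have him : w.im = -(t * s) := by simp [hw]
        have h1 : -w.re ≤ w.im := by rw [hre, him]; nlinarith [hs.2]
        have h2 : w.im ≤ 0 := by rw [him]; nlinarith [hs.1]
        have h3 := hb w (by rwa [hre]) h1 h2
        have h4 : ‖w‖ ≤ 2 * w.re := norm_le_two_mul_re (abs_le.2 ⟨h1, by linarith⟩)
        have hwpos : 0 < ‖w‖ := norm_pos_iff.2 (fun h => by rw [h] at hre; simp at hre; linarith)
        have hC : 0 ≤ C := by
          have h5 := (norm_nonneg _).trans h3
          by_contra hC
          push Not at hC
          have := mul_pos hwpos (Real.exp_pos (-w.re))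
          nlinarith
        rw [norm_mul]
        rw [hre] at h3 h4
        have h6 : ‖-(Complex.I * (t : ℂ))‖ = t := by simp [abs_of_pos ht0]
        rw [h6]
        simp only [b]
        gcongr
        exact h3.trans (by gcongr)
    have e1 := hray 1 (by simp)
    have e0 := hray 0 (by simp)
    have f1 := hvert R ⟨hεR, le_rfl⟩
    have f0 := hvert ε ⟨le_rfl, hεR⟩
    rw [intervalIntegral.integral_of_le hεR] at e1 e0
    have g1 : ∫ x in S n, G ((1 - Complex.I) * x) * (1 - Complex.I) =
        Φ (R - Complex.I * (R * (1 : ℝ))) - Φ (ε - Complex.I * (ε * (1 : ℝ))) := by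
      rw [← e1]
      simp only [Complex.ofReal_one, mul_one, sub_mul, one_mul, hS, ε, R]
    have g0 : ∫ x in S n, G x =
        Φ (R - Complex.I * (R * (0 : ℝ))) - Φ (ε - Complex.I * (ε * (0 : ℝ))) := by
      rw [← e0]
      simp [hS, ε, R]
    rw [g1, g0]
    calc _ = ‖(Φ (R - Complex.I * (R * (1 : ℝ))) - Φ (R - Complex.I * (R * (0 : ℝ)))) -
        (Φ (ε - Complex.I * (ε * (1 : ℝ))) - Φ (ε - Complex.I * (ε * (0 : ℝ))))‖ := by
          congr 1; ring
      _ ≤ _ := norm_sub_le _ _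
      _ ≤ _ := add_le_add f1 f0
  have hbt : Tendsto b atTop (𝓝 0) := by
    have := (Real.tendsto_pow_mul_exp_neg_atTop_nhds_zero 2).const_mul (2 * C)
    rw [mul_zero] at this
    refine this.congr fun t => ?_
    simp only [b]; ring
  have hb0 : Tendsto b (𝓝 0) (𝓝 0) := by
    have : Continuous b := by fun_prop
    simpa [b] using this.tendsto 0
  have hlim : Tendsto (fun n : ℕ => b ((n : ℝ) + 1) + b (1 / ((n : ℝ) + 1))) atTop (𝓝 0) := by
    have h1 : Tendsto (fun n : ℕ => (n : ℝ) + 1) atTop atTop :=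
      tendsto_atTop_add_const_right _ _ tendsto_natCast_atTop_atTop
    simpa using (hbt.comp h1).add (hb0.comp tendsto_one_div_add_atTop_nhds_zero_nat)
  have h0 := squeeze_zero_norm key hlim
  exact sub_eq_zero.1 (tendsto_nhds_unique (t1.sub t0) h0)

open scoped FourierTransform in
lemma tsum_alternating_sine {h : ℝ → ℝ} {C : ℝ} (hc : Continuous h) (hodd : ∀ x, h (-x) = -h x)
    (hb : ∀ x, 0 < x → |h x| ≤ C * x * Real.exp (-x)) {s : ℕ → ℝ}
    (hs : ∀ k : ℕ, s k = ∫ x in Ioi (0 : ℝ), h x * Real.sin ((2 * k + 1) * x)) (hsum : Summable s) :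
    ∑' k : ℕ, (-1 : ℝ) ^ k * s k = π / 2 * ∑' n : ℕ, (-1 : ℝ) ^ n * h ((2 * n + 1) * π / 2) := by
  have hC : 0 ≤ C := by
    have := (abs_nonneg _).trans (hb 1 one_pos)
    rw [mul_one] at this
    exact nonneg_of_mul_nonneg_left this (Real.exp_pos _)
  have hb2 : ∀ x, 0 < x → |h x| ≤ 6 * C / x ^ 2 := by
    intro x hx
    refine (hb x hx).trans ?_
    have := Real.pow_div_factorial_le_exp x hx.le 3
    rw [Real.exp_neg, le_div_iff₀ (by positivity), ← div_eq_mul_inv, div_mul_eq_mul_div,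
      div_le_iff₀ (Real.exp_pos _)]
    simp [Nat.factorial] at this
    nlinarith
  have hb3 : ∀ x, x ≠ 0 → |h x| ≤ 6 * C / x ^ 2 := by
    intro x hx
    rcases lt_or_gt_of_ne hx with hx | hx
    · have := hb2 (-x) (by linarith)
      rwa [hodd, abs_neg, neg_sq] at this
    · exact hb2 x hx
  set f : ℝ → ℂ := fun x => h (π * x) * Complex.exp (-(Complex.I * π * x)) with hf
  have hexp : ∀ x : ℝ, ‖Complex.exp (-(Complex.I * π * x))‖ = 1 := by
    intro x
    rw [Complex.norm_exp]
    simp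
  have hfc : Continuous f := by
    have : Continuous fun x : ℝ => (h (π * x) : ℂ) :=
      Complex.continuous_ofReal.comp (hc.comp (by fun_prop))
    fun_prop
  have hfO : f =O[cocompact ℝ] fun x : ℝ => |x| ^ (-2 : ℝ) := by
    refine Asymptotics.IsBigO.of_bound (6 * C / π ^ 2) ?_
    have : ({0} : Set ℝ)ᶜ ∈ cocompact ℝ := isCompact_singleton.compl_mem_cocompact
    filter_upwards [this] with x hx
    have hx : x ≠ 0 := hx
    have h1 := hb3 (π * x) (mul_ne_zero Real.pi_ne_zero hx)
    rw [hf, norm_mul, hexp, mul_one, Complex.norm_real, Real.norm_eq_abs]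
    refine h1.trans (le_of_eq ?_)
    rw [Real.rpow_neg (abs_nonneg _), norm_inv, Real.norm_eq_abs]
    norm_num
    field_simp
  have hint : Integrable h := by
    refine (integrable_inv_one_add_sq.const_mul (7 * C)).mono' hc.aestronglyMeasurable
      (Eventually.of_forall fun x => ?_)
    rcases eq_or_ne x 0 with rfl | hx
    · have := hodd 0
      rw [neg_zero] at this
      have h0 : h 0 = 0 := by linarith
      simp [h0, hC]
    · have h1 : |h x| ≤ C := by
        have h2 : ∀ x, 0 < x → |h x| ≤ C := fun x hx => by
          refine (hb x hx).trans ?_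
          have h3 := Real.add_one_le_exp x
          rw [Real.exp_neg, ← div_eq_mul_inv, div_le_iff₀ (Real.exp_pos _)]
          nlinarith
        rcases lt_or_gt_of_ne hx with hx | hx
        · simpa [hodd] using h2 (-x) (by linarith)
        · exact h2 x hx
      have h2 := hb3 x hx
      rw [le_div_iff₀ (by positivity)] at h2
      rw [Real.norm_eq_abs, ← div_eq_mul_inv, le_div_iff₀ (by positivity)]
      linarith
  set A : ℝ → ℝ := fun a => ∫ x in Ioi (0 : ℝ), h x * Real.sin (a * x) with hA
  have hF : ∀ n : ℤ, 𝓕 f n = -(2 * Complex.I / π * A (2 * n + 1)) := by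
    intro n
    set g : ℝ → ℂ := fun y => h y * Complex.exp (-((2 * n + 1) * y) * Complex.I) with hg
    have hgi : Integrable g := by
      refine hint.norm.mono' ?_ (Eventually.of_forall fun x => ?_)
      · have : Continuous fun x : ℝ => (h x : ℂ) := Complex.continuous_ofReal.comp hc
        exact Continuous.aestronglyMeasurable (by fun_prop)
      · rw [hg, norm_mul, Complex.norm_exp]
        simp
    have e1 : 𝓕 f n = ∫ x : ℝ, g (π * x) := by
      rw [Real.fourier_real_eq_integral_exp_smul]
      congr 1
      ext x
      simp only [hf, hg, smul_eq_mul]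
      rw [mul_left_comm, ← Complex.exp_add]
      congr 2
      push_cast; ring
    have e2 : ∫ x in Iic (0 : ℝ), g x = ∫ x in Ioi (0 : ℝ), g (-x) := by
      rw [integral_comp_neg_Ioi, neg_zero]
    have hgn : IntegrableOn (fun x => g (-x)) (Ioi 0) := hgi.comp_neg.integrableOn
    rw [e1, Measure.integral_comp_mul_left,
      ← intervalIntegral.integral_Iic_add_Ioi hgi.integrableOn hgi.integrableOn (b := 0), e2,
      ← integral_add hgn hgi.integrableOn]
    have e3 : ∀ x : ℝ, g (-x) + g x = -2 * Complex.I * ((h x * Real.sin ((2 * n + 1) * x) : ℝ) : ℂ) := by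
      intro x
      simp only [hg, hodd]
      push_cast
      rw [Complex.sin]
      have : ∀ u v : ℂ, (-(h x : ℂ)) * v + h x * u = -2 * Complex.I * (h x * ((u - v) * Complex.I / 2)) := by
        intro u v
        linear_combination (h x * (u - v)) * Complex.I_sq
      rw [← this]
      ring_nf
    simp_rw [e3]
    rw [integral_const_mul, integral_complex_ofReal, abs_of_pos (by positivity), Complex.real_smul]
    push_cast
    rw [hA]
    ring
  have hAneg : ∀ a, A (-a) = - A a := by
    intro a
    simp only [hA]
    rw [← integral_neg]
    congr 1
    ext x
    rw [neg_mul, Real.sin_neg, mul_neg]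
  have hF1 : ∀ k : ℕ, 𝓕 f ((k : ℤ) : ℝ) = -(2 * Complex.I / π * s k) := by
    intro k
    rw [hF, hs]
    simp [hA]
  have hF2 : ∀ k : ℕ, 𝓕 f ((-((k : ℤ) + 1) : ℤ) : ℝ) = 2 * Complex.I / π * s k := by
    intro k
    rw [hF, hs]
    have : (2 * ((-((k : ℤ) + 1) : ℤ) : ℝ) + 1) = -(2 * k + 1) := by push_cast; ring
    rw [this, hAneg]
    simp [hA]
  have hsumC : Summable fun k => (s k : ℂ) := Complex.summable_ofReal.2 hsum
  have hFs : Summable fun n : ℤ => 𝓕 f n := by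
    apply Summable.of_nat_of_neg_add_one
    · simp_rw [hF1]
      exact (hsumC.mul_left _).neg
    · simp_rw [hF2]
      exact hsumC.mul_left _
  have key := Real.tsum_eq_tsum_fourier_of_rpow_decay_of_summable hfc one_lt_two hfO hFs (1 / 2)
  have hfo : ∀ n : ℤ, fourier n ((1 / 2 : ℝ) : UnitAddCircle) = (-1 : ℂ) ^ n := by
    intro n
    rw [fourier_coe_apply, ← Complex.exp_pi_mul_I, ← Complex.exp_int_mul]
    congr 1
    push_cast
    ring
  have hm1 : ∀ k : ℕ, (-1 : ℂ) ^ (-((k : ℤ) + 1)) = -(-1) ^ k := by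
    intro k
    rw [zpow_neg, zpow_add₀ (by norm_num), zpow_natCast]
    rcases neg_one_pow_eq_or ℂ k with h | h <;> simp [h]
  have hfn : ∀ n : ℤ, f (1 / 2 + n) = -Complex.I * (-1) ^ n * h ((2 * n + 1) * π / 2) := by
    intro n
    have e1 : π * (1 / 2 + n) = (2 * n + 1) * π / 2 := by ring
    have e2 : -(Complex.I * π * ((1 / 2 + n : ℝ) : ℂ)) = -π / 2 * Complex.I + (-n : ℤ) * (π * Complex.I) := by
      push_cast; ring
    simp only [hf]
    rw [e1, e2, Complex.exp_add, Complex.exp_int_mul, Complex.exp_pi_mul_I, Complex.exp_neg_pi_div_two_mul_I]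
    have : (-1 : ℂ) ^ (-n) = (-1) ^ n := by
      rw [zpow_neg, ← inv_zpow]; norm_num
    rw [this]; ring
  have hsh : Summable fun n : ℕ => (h ((2 * n + 1) * π / 2) : ℂ) := by
    apply Complex.summable_ofReal.2
    have h1 : Summable fun n : ℕ => 6 * C * (1 / ((n : ℝ) + 1) ^ 2) := by
      have := (summable_nat_add_iff 1).2 (Real.summable_one_div_nat_pow.2 one_lt_two)
      simpa using this.mul_left (6 * C)
    refine Summable.of_norm_bounded h1 fun n => ?_
    refine (hb2 _ (by positivity)).trans ?_
    rw [div_eq_mul_one_div]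
    gcongr
    have : (0 : ℝ) ≤ n := Nat.cast_nonneg n
    nlinarith [Real.pi_gt_three]
  have hsg : ∀ {g : ℕ → ℂ}, Summable g → Summable fun n => (-1) ^ n * g n := by
    intro g hg
    refine Summable.of_norm ?_
    simpa using hg.norm
  have hneg : ∀ k : ℕ, h ((2 * ((-((k : ℤ) + 1) : ℤ) : ℝ) + 1) * π / 2) = - h ((2 * k + 1) * π / 2) := by
    intro k
    rw [← hodd]
    congr 1
    push_cast; ring
  rw [tsum_of_nat_of_neg_add_one, tsum_of_nat_of_neg_add_one] at key
  · simp_rw [hfo, hfn, hF1, hF2, hneg, hm1] at key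
    have l1 : ∀ n : ℕ, -Complex.I * (-1 : ℂ) ^ (n : ℤ) * (h ((2 * ((n : ℤ) : ℝ) + 1) * π / 2) : ℂ) =
      -Complex.I * (((-1) ^ n * h ((2 * n + 1) * π / 2) : ℝ) : ℂ) := by intro n; push_cast; simp; ring
    have l2 : ∀ n : ℕ, -Complex.I * -(-1 : ℂ) ^ n * ((-h ((2 * n + 1) * π / 2) : ℝ) : ℂ) =
      -Complex.I * (((-1) ^ n * h ((2 * n + 1) * π / 2) : ℝ) : ℂ) := by intro n; push_cast; ring
    have l3 : ∀ n : ℕ, -(2 * Complex.I / π * s n) * (-1 : ℂ) ^ (n : ℤ) =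
      -(2 * Complex.I / π) * (((-1) ^ n * s n : ℝ) : ℂ) := by intro n; push_cast; simp; ring
    have l4 : ∀ n : ℕ, (2 * Complex.I / π * s n) * -(-1 : ℂ) ^ n =
      -(2 * Complex.I / π) * (((-1) ^ n * s n : ℝ) : ℂ) := by intro n; push_cast; ring
    simp_rw [l1, l2, l3, l4, tsum_mul_left, ← Complex.ofReal_tsum] at key
    generalize ∑' n : ℕ, (-1 : ℝ) ^ n * h ((2 * n + 1) * π / 2) = X at key ⊢
    generalize ∑' n : ℕ, (-1 : ℝ) ^ n * s n = Y at key ⊢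
    have := congrArg Complex.im key
    simp at this
    field_simp at this ⊢
    linarith
  · simp_rw [hfo, hF1]
    simpa using (hsg (hsumC.mul_left (-(2 * Complex.I / π)))).congr fun k => by ring
  · simp_rw [hfo, hF2, hm1]
    simpa using (hsg (hsumC.mul_left (-(2 * Complex.I / π)))).congr fun k => by ring
  · simp_rw [hfn]
    simpa using (hsg (hsh.mul_left (-Complex.I))).congr fun k => by ring
  · simp_rw [hfn, hm1, hneg]
    simpa using (hsg (hsh.mul_left (-Complex.I))).congr fun k => by ring

lemma im_integral_ray_div_cos {H : ℂ → ℂ} {h : ℝ → ℝ} {C : ℝ}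
    (hd : DifferentiableOn ℂ H {w | 0 < w.re})
    (hb : ∀ w : ℂ, 0 < w.re → -w.re ≤ w.im → w.im ≤ 0 → ‖H w‖ ≤ C * ‖w‖ * Real.exp (-w.re))
    (hH : ∀ x : ℝ, H x = h x) (hc : Continuous h) (hodd : ∀ x, h (-x) = -h x) :
    (∫ x in Ioi (0 : ℝ), H ((1 - Complex.I) * x) / Complex.cos ((1 - Complex.I) * x) *
      (1 - Complex.I)).im = -π * ∑' n : ℕ, (-1 : ℝ) ^ n * h ((2 * n + 1) * π / 2) := by
  have hb' : ∀ x, 0 < x → |h x| ≤ C * x * Real.exp (-x) := by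
    intro x hx
    have := hb x (by simpa) (by simpa using hx.le) (by simp)
    rw [hH] at this
    simpa [abs_of_pos hx] using this
  have hC : 0 ≤ C := by
    have := (abs_nonneg _).trans (hb' 1 one_pos)
    rw [mul_one] at this
    exact nonneg_of_mul_nonneg_left this (Real.exp_pos _)
  set G : ℕ → ℂ → ℂ := fun k w => H w * Complex.exp (-(Complex.I * (2 * k + 1) * w)) with hG
  have hGd : ∀ k, DifferentiableOn ℂ (G k) {w | 0 < w.re} := fun k =>
    hd.mul (by fun_prop)
  have hGb : ∀ k, ∀ w : ℂ, 0 < w.re → -w.re ≤ w.im → w.im ≤ 0 →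
      ‖G k w‖ ≤ C * ‖w‖ * Real.exp (-w.re) := by
    intro k w h1 h2 h3
    rw [hG, norm_mul, Complex.norm_exp]
    refine (mul_le_of_le_one_right (norm_nonneg _) (Real.exp_le_one_iff.2 ?_)).trans (hb w h1 h2 h3)
    have : (-(Complex.I * (2 * k + 1) * w)).re = (2 * k + 1) * w.im := by simp
    rw [this]
    exact mul_nonpos_of_nonneg_of_nonpos (by positivity) h3
  set F : ℕ → ℝ → ℂ := fun k x =>
    2 * (-1) ^ k * (G k ((1 - Complex.I) * x) * (1 - Complex.I)) with hF
  have hFi : ∀ k, IntegrableOn (F k) (Ioi 0) := by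
    intro k
    have h1 : IntegrableOn (fun x : ℝ => 2 * (-1) ^ k * (G k (x - Complex.I * (x * (1 : ℝ))) *
        (1 - Complex.I))) (Ioi 0) :=
      ((integrableOn_ray (hGd k) (hGb k) (s := 1) (by simp)).mul_const _).const_mul _
    refine h1.congr_fun (fun x _ => ?_) measurableSet_Ioi
    simp [hF, sub_mul]
  have hFn : ∀ k, ∀ x ∈ Ioi (0 : ℝ), ‖F k x‖ ≤
      8 * C * (x ^ ((2 : ℝ) - 1) * Real.exp (-((2 * k + 2) * x))) := by
    intro k x hx
    have hx : 0 < x := hx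
    have hre : ((1 - Complex.I) * x).re = x := by simp
    have him : ((1 - Complex.I) * x).im = -x := by simp
    have h1 := hb ((1 - Complex.I) * x) (by rwa [hre]) (by rw [hre, him]) (by rw [him]; linarith)
    have h2 : ‖(1 - Complex.I)‖ ≤ 2 := by
      refine (norm_sub_le _ _).trans ?_
      norm_num
    have h3 : (-(Complex.I * (2 * k + 1) * ((1 - Complex.I) * x))).re = -((2 * k + 1) * x) := by simp
    have h4 : ‖(1 - Complex.I) * (x : ℂ)‖ ≤ 2 * x := by
      rw [norm_mul, Complex.norm_real, Real.norm_eq_abs, abs_of_pos hx]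
      gcongr
    rw [hre] at h1
    simp only [hF, hG, norm_mul, Complex.norm_exp, h3]
    simp only [norm_pow, norm_neg, norm_one, one_pow, mul_one, Complex.norm_two]
    calc 2 * (‖H ((1 - Complex.I) * x)‖ * Real.exp (-((2 * k + 1) * x)) * ‖1 - Complex.I‖)
        ≤ 2 * ((C * (2 * x) * Real.exp (-x)) * Real.exp (-((2 * k + 1) * x)) * 2) := by
          gcongr
          exact h1.trans (by gcongr)
      _ = 8 * C * (x * (Real.exp (-x) * Real.exp (-((2 * k + 1) * x)))) := by ring
      _ = _ := by
          rw [← Real.exp_add, show (2 : ℝ) - 1 = 1 by norm_num, Real.rpow_one]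
          ring_nf
  have hFs : Summable fun k => ∫ x in Ioi (0 : ℝ), ‖F k x‖ := by
    have h1 : Summable fun k : ℕ => 2 * C * (1 / ((k : ℝ) + 1) ^ 2) := by
      have := (summable_nat_add_iff 1).2 (Real.summable_one_div_nat_pow.2 one_lt_two)
      simpa using this.mul_left (2 * C)
    refine Summable.of_nonneg_of_le (fun k => integral_nonneg fun x => norm_nonneg _) (fun k => ?_) h1
    have h2 := Real.integral_rpow_mul_exp_neg_mul_Ioi (a := 2) (r := 2 * k + 2) two_pos (by positivity)
    have h3 : IntegrableOn (fun x : ℝ => x ^ ((2 : ℝ) - 1) * Real.exp (-((2 * k + 2) * x))) (Ioi 0) := by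
      refine (integrableOn_rpow_mul_exp_neg_mul_rpow (s := 2 - 1) (p := 1) (b := 2 * k + 2)
        (by norm_num) one_pos (by positivity)).congr_fun (fun x _ => ?_) measurableSet_Ioi
      simp only [Real.rpow_one, neg_mul]
    refine (setIntegral_mono_on (hFi k).norm (h3.const_mul (8 * C)) measurableSet_Ioi (hFn k)).trans ?_
    rw [integral_const_mul, h2, Real.Gamma_two, mul_one, Real.rpow_two, one_div, one_div,
      show (2 * (k : ℝ) + 2) = 2 * (k + 1) by ring]
    apply le_of_eq
    field_simp
    ring
  have hsum := hasSum_integral_of_summable_integral_norm hFi hFs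
  have hpt : ∫ x in Ioi (0 : ℝ), ∑' k, F k x = ∫ x in Ioi (0 : ℝ), H ((1 - Complex.I) * x) /
      Complex.cos ((1 - Complex.I) * x) * (1 - Complex.I) := by
    refine setIntegral_congr_fun measurableSet_Ioi fun x hx => ?_
    have hx : 0 < x := hx
    set w : ℂ := (1 - Complex.I) * x with hw
    set e : ℂ := Complex.exp (-(Complex.I * w)) with he
    have he0 : e ≠ 0 := Complex.exp_ne_zero _
    have hen : ‖-e ^ 2‖ < 1 := by
      rw [norm_neg, norm_pow, he, Complex.norm_exp]
      have : (-(Complex.I * w)).re = -x := by simp [hw]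
      rw [this]
      exact pow_lt_one₀ (Real.exp_pos _).le (Real.exp_lt_one_iff.2 (by linarith)) two_ne_zero
    have hcos : Complex.cos w = (e⁻¹ + e) / 2 := by
      rw [he, ← Complex.exp_neg, Complex.cos, neg_neg]
      ring_nf
    have h1 : ∀ k, F k x = H w * (1 - Complex.I) * 2 * e * (-e ^ 2) ^ k := by
      intro k
      simp only [hF, hG]
      have : Complex.exp (-(Complex.I * (2 * k + 1) * w)) = e * (e ^ 2) ^ k := by
        rw [he, ← Complex.exp_nat_mul, ← Complex.exp_nat_mul, ← Complex.exp_add]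
        congr 1
        push_cast
        ring
      rw [← hw, this, neg_pow (e ^ 2)]
      ring
    have h2 : 1 + e ^ 2 ≠ 0 := by
      intro h0
      have : -e ^ 2 = 1 := by linear_combination -h0
      rw [this, norm_one] at hen
      exact lt_irrefl _ hen
    simp_rw [h1, tsum_mul_left, tsum_geometric_of_norm_lt_one hen, hcos]
    have h3 : e⁻¹ + e ≠ 0 := by
      have : e⁻¹ + e = e⁻¹ * (1 + e ^ 2) := by field_simp
      rw [this]
      exact mul_ne_zero (inv_ne_zero he0) h2
    have h4 : e⁻¹ + e = (1 + e ^ 2) / e := by field_simp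
    rw [h4, sub_neg_eq_add]
    field_simp
  rw [hpt] at hsum
  set s : ℕ → ℝ := fun k => ∫ x in Ioi (0 : ℝ), h x * Real.sin ((2 * k + 1) * x) with hs
  have hFk : ∀ k, (∫ x in Ioi (0 : ℝ), F k x).im = -2 * ((-1) ^ k * s k) := by
    intro k
    have hi0 : IntegrableOn (fun x : ℝ => G k x) (Ioi 0) := by
      simpa using integrableOn_ray (hGd k) (hGb k) (s := 0) (by simp)
    simp only [hF]
    rw [integral_const_mul, integral_ray_eq (hGd k) (hGb k)]
    have h1 : (2 * (-1) ^ k : ℂ) = ((2 * (-1) ^ k : ℝ) : ℂ) := by push_cast; rfl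
    have h2 : (∫ x in Ioi (0 : ℝ), G k x).im = ∫ x in Ioi (0 : ℝ), (G k x).im :=
      (Complex.imCLM.integral_comp_comm hi0).symm
    rw [h1, Complex.im_ofReal_mul, h2]
    have h3 : ∀ x : ℝ, (G k x).im = -(h x * Real.sin ((2 * k + 1) * x)) := by
      intro x
      have : -(Complex.I * (2 * k + 1) * x) = ((-((2 * k + 1) * x) : ℝ) : ℂ) * Complex.I := by
        push_cast; ring
      simp only [hG]
      rw [hH, Complex.im_ofReal_mul, this, Complex.exp_ofReal_mul_I_im, Real.sin_neg]
      ring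
    simp_rw [h3]
    rw [integral_neg, hs]
    ring
  have him := Complex.hasSum_im hsum
  simp_rw [hFk] at him
  have hss : Summable s := by
    have h1 : Summable fun k => (-1 : ℝ) ^ k * s k := by
      simpa using him.summable.mul_left (-2)⁻¹
    refine Summable.of_norm ?_
    simpa using h1.norm
  rw [← him.tsum_eq, tsum_mul_left, tsum_alternating_sine hc hodd hb' (fun _ => rfl) hss]
  ring

/-- The function `w ^ n / cosh w ^ 3`. -/
noncomputable def powDivCosh (n : ℕ) (w : ℂ) : ℂ := w ^ n / Complex.cosh w ^ 3

/-- The derivative of `powDivCosh n`. -/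
noncomputable def powDivCoshDeriv (n : ℕ) (w : ℂ) : ℂ :=
  n * w ^ (n - 1) / Complex.cosh w ^ 3 - 3 * w ^ n * Complex.sinh w / Complex.cosh w ^ 4

/-- Half the sum of `powDivCosh n` and its second derivative. -/
noncomputable def powDivCoshAux (n : ℕ) (w : ℂ) : ℂ :=
  (n * (n - 1 : ℕ) * w ^ (n - 1 - 1) / Complex.cosh w ^ 3
    - 6 * n * w ^ (n - 1) * Complex.sinh w / Complex.cosh w ^ 4
    + w ^ n * (10 / Complex.cosh w ^ 3 - 12 / Complex.cosh w ^ 5)) / 2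

lemma cosh_ne_zero_of_abs_im_le_re {w : ℂ} (h : |w.im| ≤ w.re) : Complex.cosh w ≠ 0 := by
  have := exp_re_div_three_le_norm_cosh h
  rw [← norm_pos_iff]
  exact lt_of_lt_of_le (by positivity) this

lemma hasDerivAt_powDivCosh (n : ℕ) {w : ℂ} (hw : Complex.cosh w ≠ 0) :
    HasDerivAt (powDivCosh n) (powDivCoshDeriv n w) w := by
  have h1 := (hasDerivAt_pow n w).div ((Complex.hasDerivAt_cosh w).pow 3) (pow_ne_zero 3 hw)
  refine h1.congr_deriv ?_
  simp only [powDivCoshDeriv, Pi.pow_apply]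
  field_simp
  push_cast
  ring

lemma hasDerivAt_powDivCoshDeriv (n : ℕ) {w : ℂ} (hw : Complex.cosh w ≠ 0) :
    HasDerivAt (powDivCoshDeriv n) (2 * powDivCoshAux n w - powDivCosh n w) w := by
  have h1 := (((hasDerivAt_pow (n - 1) w).const_mul (n : ℂ)).div
    ((Complex.hasDerivAt_cosh w).pow 3) (pow_ne_zero 3 hw)).sub
    ((((hasDerivAt_pow n w).const_mul 3).mul (Complex.hasDerivAt_sinh w)).div
    ((Complex.hasDerivAt_cosh w).pow 4) (pow_ne_zero 4 hw))
  refine h1.congr_deriv ?_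
  have h2 := Complex.sinh_sq w
  simp only [powDivCoshAux, powDivCosh, Pi.pow_apply, Pi.mul_apply]
  field_simp
  push_cast
  ring_nf
  rw [h2]
  ring

lemma inv_cosh_isBigO : (fun w => (Complex.cosh w)⁻¹) =O[𝓟 {w : ℂ | |w.im| ≤ w.re}]
    fun w => Real.exp (-w.re) := by
  refine isBigO_principal.2 ⟨3, fun w hw => ?_⟩
  have h1 := exp_re_div_three_le_norm_cosh hw
  have h2 : 0 < ‖Complex.cosh w‖ := norm_pos_iff.2 (cosh_ne_zero_of_abs_im_le_re hw)
  rw [norm_inv, Real.norm_eq_abs, Real.abs_exp, Real.exp_neg, ← div_eq_mul_inv, ← one_div,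
    div_le_div_iff₀ h2 (Real.exp_pos _)]
  linarith

lemma pow_isBigO_exp_re (N : ℕ) : (fun w : ℂ => w ^ N) =O[𝓟 {w : ℂ | |w.im| ≤ w.re}]
    fun w => Real.exp w.re := by
  refine isBigO_principal.2 ⟨2 ^ N * N.factorial, fun w hw => ?_⟩
  have h0 : 0 ≤ w.re := (abs_nonneg _).trans hw
  have h1 := Real.pow_div_factorial_le_exp w.re h0 N
  rw [div_le_iff₀ (by positivity)] at h1
  rw [norm_pow, Real.norm_eq_abs, Real.abs_exp]
  calc ‖w‖ ^ N ≤ (2 * w.re) ^ N := by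
        gcongr
        exact norm_le_two_mul_re hw
    _ = 2 ^ N * w.re ^ N := mul_pow _ _ _
    _ ≤ 2 ^ N * (Real.exp w.re * N.factorial) := by gcongr
    _ = _ := by ring

lemma sinh_isBigO : (fun w => Complex.sinh w) =O[𝓟 {w : ℂ | |w.im| ≤ w.re}]
    fun w => ‖w‖ * Real.exp w.re := by
  refine isBigO_principal.2 ⟨1, fun w hw => ?_⟩
  rw [norm_mul, norm_norm, Real.norm_eq_abs, Real.abs_exp, one_mul]
  exact norm_sinh_le ((abs_nonneg _).trans hw)

lemma powDivCoshAux_isBigO {n : ℕ} (hn : n ≠ 2) (hn0 : n ≠ 0) :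
    powDivCoshAux n =O[𝓟 {w : ℂ | |w.im| ≤ w.re}] fun w => ‖w‖ * Real.exp (-w.re) := by
  set l : Filter ℂ := 𝓟 {w : ℂ | |w.im| ≤ w.re}
  have hinv : (fun w => (Complex.cosh w)⁻¹) =O[l] fun w => Real.exp (-w.re) := inv_cosh_isBigO
  have hinv1 : (fun w => (Complex.cosh w)⁻¹) =O[l] fun _ => (1 : ℝ) := by
    refine hinv.trans (isBigO_principal.2 ⟨1, fun w hw => ?_⟩)
    have : 0 ≤ w.re := (abs_nonneg _).trans hw
    simpa using this
  have hpow : ∀ N : ℕ, (fun w : ℂ => w ^ N) =O[l] fun w => Real.exp w.re := pow_isBigO_exp_re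
  have hsinh : (fun w => Complex.sinh w) =O[l] fun w => ‖w‖ * Real.exp w.re := sinh_isBigO
  have hid : (fun w : ℂ => w) =O[l] fun w => ‖w‖ := (isBigO_refl _ _).norm_right
  have hq : ∀ N : ℕ, (fun w : ℂ => w ^ N * (Complex.cosh w)⁻¹ * (Complex.cosh w)⁻¹) =O[l]
      fun w => Real.exp (-w.re) := by
    intro N
    refine (((hpow N).mul hinv).mul hinv).congr_right fun w => ?_
    rw [← Real.exp_add, add_neg_cancel, Real.exp_zero, one_mul]
  have ht : (fun w : ℂ => Complex.sinh w * (Complex.cosh w)⁻¹) =O[l] fun w => ‖w‖ := by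
    refine (hsinh.mul hinv).congr_right fun w => ?_
    rw [mul_assoc, ← Real.exp_add, add_neg_cancel, Real.exp_zero, mul_one]
  have h1 : (fun w : ℂ => n * (n - 1 : ℕ) * w ^ (n - 1 - 1) / Complex.cosh w ^ 3) =O[l]
      fun w => ‖w‖ * Real.exp (-w.re) := by
    obtain h | ⟨N, rfl⟩ : n = 1 ∨ ∃ N, n = N + 3 := by
      rcases n with _ | _ | _ | N
      · exact absurd rfl hn0
      · exact Or.inl rfl
      · exact absurd rfl hn
      · exact Or.inr ⟨N, rfl⟩
    · subst h
      simpa using isBigO_zero _ _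
    · refine (((hid.mul (hq N)).mul hinv1).const_mul_left (((N + 3 : ℕ) : ℂ) * (N + 3 - 1 : ℕ))).congr
        (fun w => ?_) (fun w => by rw [mul_one])
      have : N + 3 - 1 - 1 = N + 1 := by omega
      rw [this, pow_succ, div_eq_mul_inv, ← inv_pow]
      ring
  have h2 : (fun w : ℂ => 6 * n * w ^ (n - 1) * Complex.sinh w / Complex.cosh w ^ 4) =O[l]
      fun w => ‖w‖ * Real.exp (-w.re) := by
    refine (((ht.mul (hq (n - 1))).mul hinv1).const_mul_left (6 * (n : ℂ))).congr
        (fun w => ?_) (fun w => by rw [mul_one])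
    rw [div_eq_mul_inv, ← inv_pow]
    ring
  have h3 : (fun w : ℂ => w ^ n * (10 / Complex.cosh w ^ 3 - 12 / Complex.cosh w ^ 5)) =O[l]
      fun w => ‖w‖ * Real.exp (-w.re) := by
    have h4 : (fun w => 10 * (Complex.cosh w)⁻¹ - 12 * (Complex.cosh w)⁻¹ ^ 3) =O[l]
        fun _ => (1 : ℝ) := by
      refine (hinv1.const_mul_left 10).sub (IsBigO.const_mul_left ?_ 12)
      simpa using hinv1.pow 3
    refine ((hid.mul (hq (n - 1))).mul h4).congr (fun w => ?_) (fun w => by rw [mul_one])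
    obtain ⟨N, rfl⟩ := Nat.exists_eq_succ_of_ne_zero hn0
    rw [Nat.succ_sub_one, Nat.succ_eq_add_one, pow_succ, div_eq_mul_inv, div_eq_mul_inv,
      ← inv_pow, ← inv_pow]
    ring
  exact (((h1.sub h2).add h3).const_mul_left 2⁻¹).congr_left fun w => by
    rw [powDivCoshAux]
    ring

lemma abs_im_ray_le {x : ℝ} (hx : 0 ≤ x) :
    |((1 - Complex.I) * (x : ℂ)).im| ≤ ((1 - Complex.I) * (x : ℂ)).re := by
  simp [abs_of_nonneg hx]

lemma abs_im_ray_mul_I_le {x : ℝ} (hx : 0 ≤ x) :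
    |((1 - Complex.I) * (x : ℂ) * Complex.I).im| ≤ ((1 - Complex.I) * (x : ℂ) * Complex.I).re := by
  simp [abs_of_nonneg hx]

lemma cosh_ray_ne_zero {x : ℝ} (hx : 0 ≤ x) : Complex.cosh ((1 - Complex.I) * x) ≠ 0 :=
  cosh_ne_zero_of_abs_im_le_re (abs_im_ray_le hx)

lemma cos_ray_ne_zero {x : ℝ} (hx : 0 ≤ x) : Complex.cos ((1 - Complex.I) * x) ≠ 0 := by
  rw [← Complex.cosh_mul_I]
  exact cosh_ne_zero_of_abs_im_le_re (abs_im_ray_mul_I_le hx)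

lemma tendsto_ray : Tendsto (fun x : ℝ => (1 - Complex.I) * (x : ℂ)) (𝓟 (Ici 0))
    (𝓟 {w : ℂ | |w.im| ≤ w.re}) :=
  tendsto_principal_principal.2 fun _ hx => abs_im_ray_le hx

lemma tendsto_ray_mul_I : Tendsto (fun x : ℝ => (1 - Complex.I) * (x : ℂ) * Complex.I) (𝓟 (Ici 0))
    (𝓟 {w : ℂ | |w.im| ≤ w.re}) :=
  tendsto_principal_principal.2 fun _ hx => abs_im_ray_mul_I_le hx

lemma inv_cosh_ray_isBigO : (fun x : ℝ => (Complex.cosh ((1 - Complex.I) * x))⁻¹) =O[𝓟 (Ici 0)]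
    fun x => Real.exp (-x) := by
  simpa [Function.comp_def] using inv_cosh_isBigO.comp_tendsto tendsto_ray

lemma inv_cos_ray_isBigO : (fun x : ℝ => (Complex.cos ((1 - Complex.I) * x))⁻¹) =O[𝓟 (Ici 0)]
    fun x => Real.exp (-x) := by
  simpa [Function.comp_def, Complex.cosh_mul_I] using
    inv_cosh_isBigO.comp_tendsto tendsto_ray_mul_I

lemma pow_ray_isBigO (N : ℕ) : (fun x : ℝ => ((1 - Complex.I) * (x : ℂ)) ^ N) =O[𝓟 (Ici 0)]
    fun x => Real.exp x := by
  simpa [Function.comp_def] using (pow_isBigO_exp_re N).comp_tendsto tendsto_ray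

lemma norm_ray_isBigO : (fun x : ℝ => ‖(1 - Complex.I) * (x : ℂ)‖) =O[𝓟 (Ici 0)]
    fun x => Real.exp x := by
  refine IsBigO.norm_left ?_
  simpa only [pow_one] using pow_ray_isBigO 1

lemma sinh_ray_isBigO : (fun x : ℝ => Complex.sinh ((1 - Complex.I) * x)) =O[𝓟 (Ici 0)]
    fun x => Real.exp x * Real.exp x := by
  refine (sinh_isBigO.comp_tendsto tendsto_ray).trans ?_
  refine norm_ray_isBigO.mul ?_
  simpa [Function.comp_def] using isBigO_refl (fun x : ℝ => Real.exp x) _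

lemma sin_ray_isBigO : (fun x : ℝ => Complex.sin ((1 - Complex.I) * x)) =O[𝓟 (Ici 0)]
    fun x => Real.exp x * Real.exp x := by
  have h : (fun x : ℝ => Complex.sinh ((1 - Complex.I) * x * Complex.I)) =O[𝓟 (Ici 0)]
      fun x => Real.exp x * Real.exp x := by
    refine (sinh_isBigO.comp_tendsto tendsto_ray_mul_I).trans (IsBigO.mul ?_ ?_)
    · simpa [Function.comp_def] using norm_ray_isBigO
    · simpa [Function.comp_def] using isBigO_refl (fun x : ℝ => Real.exp x) _
  refine (h.const_mul_left (-Complex.I)).congr_left fun x => ?_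
  rw [Complex.sinh_mul_I, mul_comm (Complex.sin _), ← mul_assoc]
  simp

/-- An antiderivative of `powDivCosh n w / cos w ^ 3 - powDivCoshAux n w / cos w`. -/
noncomputable def powDivCoshPrim (n : ℕ) (w : ℂ) : ℂ :=
  (powDivCosh n w * Complex.sin w / Complex.cos w ^ 2 - powDivCoshDeriv n w / Complex.cos w) / 2

lemma hasDerivAt_powDivCoshPrim (n : ℕ) {w : ℂ} (hw : Complex.cosh w ≠ 0)
    (hw' : Complex.cos w ≠ 0) : HasDerivAt (powDivCoshPrim n)
      (powDivCosh n w / Complex.cos w ^ 3 - powDivCoshAux n w / Complex.cos w) w := by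
  have h1 := ((((hasDerivAt_powDivCosh n hw).mul (Complex.hasDerivAt_sin w)).div
    ((Complex.hasDerivAt_cos w).pow 2) (pow_ne_zero 2 hw')).sub
    ((hasDerivAt_powDivCoshDeriv n hw).div (Complex.hasDerivAt_cos w) hw')).div_const 2
  refine h1.congr_deriv ?_
  have h2 := Complex.sin_sq w
  simp only [Pi.pow_apply, Pi.mul_apply]
  field_simp
  push_cast
  ring_nf
  rw [h2]
  ring

lemma powDivCosh_ray_isBigO (n : ℕ) :
    (fun x : ℝ => powDivCosh n ((1 - Complex.I) * x) / Complex.cos ((1 - Complex.I) * x) ^ 3)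
      =O[𝓟 (Ici 0)] fun x => Real.exp (-5 * x) := by
  refine (((pow_ray_isBigO n).mul (inv_cosh_ray_isBigO.pow 3)).mul
    (inv_cos_ray_isBigO.pow 3)).congr (fun x => ?_) fun x => ?_
  · simp only [powDivCosh]
    field_simp
  · rw [← Real.exp_nat_mul, ← Real.exp_add, ← Real.exp_add]
    congr 1
    push_cast
    ring

lemma powDivCoshAux_ray_isBigO {n : ℕ} (hn : n ≠ 2) (hn0 : n ≠ 0) :
    (fun x : ℝ => powDivCoshAux n ((1 - Complex.I) * x) / Complex.cos ((1 - Complex.I) * x))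
      =O[𝓟 (Ici 0)] fun x => Real.exp (-1 * x) := by
  have h := (powDivCoshAux_isBigO hn hn0).comp_tendsto tendsto_ray
  have h' : (fun x : ℝ => powDivCoshAux n ((1 - Complex.I) * x)) =O[𝓟 (Ici 0)]
      fun x => Real.exp x * Real.exp (-x) := by
    refine h.trans (norm_ray_isBigO.mul ?_)
    simpa [Function.comp_def] using isBigO_refl (fun x : ℝ => Real.exp (-x)) _
  refine (h'.mul inv_cos_ray_isBigO).congr (fun x => (div_eq_mul_inv _ _).symm) fun x => ?_
  rw [← Real.exp_add, ← Real.exp_add]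
  congr 1
  ring

lemma powDivCoshPrim_ray_isBigO (n : ℕ) :
    (fun x : ℝ => powDivCoshPrim n ((1 - Complex.I) * x)) =O[𝓟 (Ici 0)]
      fun x => Real.exp (-x) := by
  have hle : (fun x : ℝ => Real.exp (-2 * x)) =O[𝓟 (Ici 0)] fun x => Real.exp (-x) := by
    refine isBigO_principal.2 ⟨1, fun x hx => ?_⟩
    have : 0 ≤ x := hx
    rw [Real.norm_eq_abs, Real.norm_eq_abs, Real.abs_exp, Real.abs_exp, one_mul, Real.exp_le_exp]
    linarith
  have hle' : (fun x : ℝ => Real.exp (-3 * x)) =O[𝓟 (Ici 0)] fun x => Real.exp (-x) := by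
    refine isBigO_principal.2 ⟨1, fun x hx => ?_⟩
    have : 0 ≤ x := hx
    rw [Real.norm_eq_abs, Real.norm_eq_abs, Real.abs_exp, Real.abs_exp, one_mul, Real.exp_le_exp]
    linarith
  have h1 := (((((pow_ray_isBigO n).mul (inv_cosh_ray_isBigO.pow 3)).mul sin_ray_isBigO).mul
    (inv_cos_ray_isBigO.pow 2)).congr_right (g₂ := fun x : ℝ => Real.exp (-2 * x)) fun x => by
      simp only [← Real.exp_nat_mul, ← Real.exp_add]
      congr 1
      push_cast
      ring).trans hle
  have h2 := ((((pow_ray_isBigO (n - 1)).const_mul_left (n : ℂ)).mul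
    (inv_cosh_ray_isBigO.pow 3)).mul inv_cos_ray_isBigO).congr_right
    (g₂ := fun x : ℝ => Real.exp (-3 * x)) (fun x => by
      simp only [← Real.exp_nat_mul, ← Real.exp_add]
      congr 1
      push_cast
      ring) |>.trans hle'
  have h3 := (((((pow_ray_isBigO n).const_mul_left 3).mul (inv_cosh_ray_isBigO.pow 4)).mul
    sinh_ray_isBigO).mul inv_cos_ray_isBigO).congr_right
    (g₂ := fun x : ℝ => Real.exp (-2 * x)) (fun x => by
      simp only [← Real.exp_nat_mul, ← Real.exp_add]
      congr 1
      push_cast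
      ring) |>.trans hle
  refine ((h1.sub (h2.sub h3)).const_mul_left 2⁻¹).congr_left fun x => ?_
  simp only [powDivCoshPrim, powDivCosh, powDivCoshDeriv, div_eq_mul_inv, inv_pow]
  ring

lemma integrableOn_of_isBigO_exp {f : ℝ → ℂ} {b : ℝ} (hb : 0 < b)
    (hf : ContinuousOn f (Ici 0)) (h : f =O[𝓟 (Ici 0)] fun x => Real.exp (-b * x)) :
    IntegrableOn f (Ioi 0) :=
  ((hf.locallyIntegrableOn measurableSet_Ici).integrableOn_of_isBigO_atTop
    (h.mono (le_principal_iff.2 (Ici_mem_atTop 0)))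
    ⟨Ioi 0, Ioi_mem_atTop 0, exp_neg_integrableOn_Ioi 0 hb⟩).mono_set Ioi_subset_Ici_self

lemma im_integral_powDivCosh_ray {n : ℕ} (hn : n ≠ 2) (hn0 : n ≠ 0) :
    (∫ x in Ioi (0 : ℝ), powDivCosh n ((1 - Complex.I) * x) /
        Complex.cos ((1 - Complex.I) * x) ^ 3 * (1 - Complex.I)).im =
      (∫ x in Ioi (0 : ℝ), powDivCoshAux n ((1 - Complex.I) * x) /
        Complex.cos ((1 - Complex.I) * x) * (1 - Complex.I)).im := by
  have hc1 : ContinuousOn (fun x : ℝ => powDivCosh n ((1 - Complex.I) * x) /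
      Complex.cos ((1 - Complex.I) * x) ^ 3) (Ici 0) := by
    unfold powDivCosh
    refine ContinuousOn.div (ContinuousOn.div (by fun_prop) (by fun_prop) fun x hx => ?_)
      (by fun_prop) fun x hx => ?_
    · exact pow_ne_zero _ (cosh_ray_ne_zero hx)
    · exact pow_ne_zero _ (cos_ray_ne_zero hx)
  have hc2 : ContinuousOn (fun x : ℝ => powDivCoshAux n ((1 - Complex.I) * x) /
      Complex.cos ((1 - Complex.I) * x)) (Ici 0) := by
    have hcosh : ∀ N : ℕ, ∀ x ∈ Ici (0 : ℝ), Complex.cosh ((1 - Complex.I) * x) ^ N ≠ 0 :=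
      fun N x hx => pow_ne_zero _ (cosh_ray_ne_zero hx)
    refine ContinuousOn.div ?_ (by fun_prop) fun x hx => cos_ray_ne_zero hx
    unfold powDivCoshAux
    refine ContinuousOn.div_const (((ContinuousOn.div (by fun_prop) (by fun_prop) (hcosh 3)).sub
      (ContinuousOn.div (by fun_prop) (by fun_prop) (hcosh 4))).add
      (ContinuousOn.mul (by fun_prop) ((ContinuousOn.div (by fun_prop) (by fun_prop) (hcosh 3)).sub
        (ContinuousOn.div (by fun_prop) (by fun_prop) (hcosh 5))))) 2
  have hi1 := (integrableOn_of_isBigO_exp (by norm_num) hc1 (powDivCosh_ray_isBigO n)).mul_const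
    (1 - Complex.I)
  have hi2 := (integrableOn_of_isBigO_exp (by norm_num) hc2
    (powDivCoshAux_ray_isBigO hn hn0)).mul_const (1 - Complex.I)
  have hlim : Tendsto (fun x : ℝ => powDivCoshPrim n ((1 - Complex.I) * x)) atTop (𝓝 0) :=
    ((powDivCoshPrim_ray_isBigO n).mono (le_principal_iff.2 (Ici_mem_atTop 0))).trans_tendsto
      Real.tendsto_exp_neg_atTop_nhds_zero
  have hd : ∀ x ∈ Ici (0 : ℝ), HasDerivAt
      (fun x : ℝ => powDivCoshPrim n ((1 - Complex.I) * x))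
      (powDivCosh n ((1 - Complex.I) * x) / Complex.cos ((1 - Complex.I) * x) ^ 3 *
        (1 - Complex.I) - powDivCoshAux n ((1 - Complex.I) * x) /
        Complex.cos ((1 - Complex.I) * x) * (1 - Complex.I)) x := by
    intro x hx
    have h1 := hasDerivAt_powDivCoshPrim n (cosh_ray_ne_zero hx) (cos_ray_ne_zero hx)
    have h2 : HasDerivAt (fun z : ℂ => (1 - Complex.I) * z) (1 - Complex.I) (x : ℂ) := by
      simpa using (hasDerivAt_id (x : ℂ)).const_mul (1 - Complex.I)
    have h3 := (h1.comp (x : ℂ) h2).comp_ofReal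
    rw [sub_mul] at h3
    exact h3
  have h := integral_Ioi_of_hasDerivAt_of_tendsto' hd (hi1.sub hi2) hlim
  rw [integral_sub hi1 hi2, sub_eq_iff_eq_add] at h
  rw [h]
  have h0 : powDivCoshPrim n ((1 - Complex.I) * (0 : ℝ)) =
      ((-(n * 0 ^ (n - 1)) / 2 : ℝ) : ℂ) := by
    simp [powDivCoshPrim, powDivCosh, powDivCoshDeriv, hn0]
  rw [h0, Complex.add_im, zero_sub, Complex.neg_im, Complex.ofReal_im, neg_zero, zero_add]

lemma cosh_ne_zero_of_re_pos {w : ℂ} (h : 0 < w.re) : Complex.cosh w ≠ 0 := by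
  intro h0
  rw [← Complex.cos_mul_I, Complex.cos_eq_zero_iff] at h0
  obtain ⟨k, hk⟩ := h0
  have := congrArg Complex.im hk
  rw [show ((2 * (k : ℂ) + 1) * π / 2) = (((2 * k + 1) * π / 2 : ℝ) : ℂ) by push_cast; ring,
    Complex.ofReal_im] at this
  simp at this
  exact h.ne' this

lemma differentiableOn_powDivCoshAux (n : ℕ) :
    DifferentiableOn ℂ (powDivCoshAux n) {w | 0 < w.re} := by
  have hcosh : ∀ N : ℕ, ∀ w ∈ {w : ℂ | 0 < w.re}, Complex.cosh w ^ N ≠ 0 :=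
    fun N w hw => pow_ne_zero _ (cosh_ne_zero_of_re_pos hw)
  unfold powDivCoshAux
  exact DifferentiableOn.div_const
    (((DifferentiableOn.div (by fun_prop) (by fun_prop) (hcosh 3)).sub
    (DifferentiableOn.div (by fun_prop) (by fun_prop) (hcosh 4))).add
    (DifferentiableOn.mul (by fun_prop) ((DifferentiableOn.div (by fun_prop) (by fun_prop)
      (hcosh 3)).sub (DifferentiableOn.div (by fun_prop) (by fun_prop) (hcosh 5))))) 2

/-- The restriction of `powDivCoshAux n` to the real line. -/
noncomputable def powDivCoshAuxReal (n : ℕ) (t : ℝ) : ℝ :=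
  (n * (n - 1 : ℕ) * t ^ (n - 1 - 1) / Real.cosh t ^ 3
    - 6 * n * t ^ (n - 1) * Real.sinh t / Real.cosh t ^ 4
    + t ^ n * (10 / Real.cosh t ^ 3 - 12 / Real.cosh t ^ 5)) / 2

lemma continuous_powDivCoshAuxReal (n : ℕ) : Continuous (powDivCoshAuxReal n) := by
  have hcosh : ∀ N : ℕ, ∀ t : ℝ, Real.cosh t ^ N ≠ 0 :=
    fun N t => pow_ne_zero _ (Real.cosh_pos t).ne'
  unfold powDivCoshAuxReal
  exact Continuous.div_const
    (((Continuous.div (by fun_prop) (by fun_prop) (hcosh 3)).sub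
    (Continuous.div (by fun_prop) (by fun_prop) (hcosh 4))).add
    (Continuous.mul (by fun_prop) ((Continuous.div (by fun_prop) (by fun_prop)
      (hcosh 3)).sub (Continuous.div (by fun_prop) (by fun_prop) (hcosh 5))))) 2

lemma powDivCoshAuxReal_neg {n : ℕ} (hn : Odd n) (t : ℝ) :
    powDivCoshAuxReal n (-t) = -powDivCoshAuxReal n t := by
  obtain ⟨k, rfl⟩ := hn
  simp only [powDivCoshAuxReal, Real.cosh_neg, Real.sinh_neg, Nat.add_sub_cancel]
  have h1 : (-t) ^ (2 * k + 1) = -t ^ (2 * k + 1) := Odd.neg_pow ⟨k, rfl⟩ t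
  have h2 : (-t) ^ (2 * k) = t ^ (2 * k) := Even.neg_pow ⟨k, two_mul k⟩ t
  rw [h1, h2]
  rcases k with _ | k
  · simp
    ring
  · have h3 : (-t) ^ (2 * (k + 1) - 1) = -t ^ (2 * (k + 1) - 1) := Odd.neg_pow ⟨k, by omega⟩ t
    rw [h3]
    ring

lemma im_integral_powDivCosh_ray_eq_tsum {n : ℕ} (hn : Odd n) :
    (∫ x in Ioi (0 : ℝ), powDivCosh n ((1 - Complex.I) * x) /
        Complex.cos ((1 - Complex.I) * x) ^ 3 * (1 - Complex.I)).im =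
      -π * ∑' m : ℕ, (-1 : ℝ) ^ m * powDivCoshAuxReal n ((2 * m + 1) * π / 2) := by
  have hn2 : n ≠ 2 := by rintro rfl; exact absurd hn (by decide)
  rw [im_integral_powDivCosh_ray hn2 hn.pos.ne']
  obtain ⟨C, hC⟩ := isBigO_principal.1 (powDivCoshAux_isBigO hn2 hn.pos.ne')
  refine im_integral_ray_div_cos (C := C) (differentiableOn_powDivCoshAux n) (fun w hw h1 h2 => ?_)
    (fun x => ?_) (continuous_powDivCoshAuxReal n) (powDivCoshAuxReal_neg hn)
  · have := hC w (show |w.im| ≤ w.re from abs_le.2 ⟨h1, h2.trans hw.le⟩)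
    rwa [norm_mul, norm_norm, Real.norm_eq_abs, Real.abs_exp, ← mul_assoc] at this
  · simp only [powDivCoshAux, powDivCoshAuxReal]
    push_cast
    rfl

lemma one_sub_I_pow (p : ℕ) : (1 - Complex.I) ^ (4 * p + 2) = -2 * Complex.I * (-4) ^ p := by
  have h1 : (1 - Complex.I) ^ 2 = -2 * Complex.I := by
    linear_combination Complex.I_sq
  have h2 : (1 - Complex.I) ^ 4 = -4 := by
    rw [show 4 = 2 * 2 from rfl, pow_mul, h1, mul_pow, Complex.I_sq]
    norm_num
  rw [pow_add, pow_mul, h1, h2]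
  ring

lemma two_mul_cos_mul_cosh_ray (x : ℝ) :
    2 * Complex.cos ((1 - Complex.I) * x) * Complex.cosh ((1 - Complex.I) * x) =
      ((Real.cos (2 * x) + Real.cosh (2 * x) : ℝ) : ℂ) := by
  push_cast
  rw [← Complex.cos_mul_I, ← Complex.cos_mul_I, Complex.cos_add_cos, mul_right_comm]
  have h1 : (2 * (x : ℂ) + 2 * x * Complex.I) / 2 = (1 - Complex.I) * x * Complex.I := by
    linear_combination (x : ℂ) * Complex.I_sq
  have h2 : (2 * (x : ℂ) - 2 * x * Complex.I) / 2 = (1 - Complex.I) * x := by ring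
  rw [h1, h2]

lemma powDivCosh_ray_eq (p : ℕ) {x : ℝ} (hx : 0 ≤ x) :
    powDivCosh (4 * p + 1) ((1 - Complex.I) * x) /
        Complex.cos ((1 - Complex.I) * x) ^ 3 * (1 - Complex.I) =
      ((-16 * (-4) ^ p * (x ^ (4 * p + 1) / (Real.cos (2 * x) + Real.cosh (2 * x)) ^ 3) : ℝ) : ℂ)
        * Complex.I := by
  have h1 := cosh_ray_ne_zero hx
  have h2 := cos_ray_ne_zero hx
  have h3 := two_mul_cos_mul_cosh_ray x
  rw [Complex.ofReal_mul, Complex.ofReal_div, Complex.ofReal_pow (_ + _), ← h3]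
  have h4 : ((1 - Complex.I) * (x : ℂ)) ^ (4 * p + 1) * (1 - Complex.I) =
      -2 * Complex.I * (-4) ^ p * x ^ (4 * p + 1) := by
    rw [← one_sub_I_pow, mul_pow]
    ring
  rw [powDivCosh, div_div, div_mul_eq_mul_div, h4]
  field_simp
  push_cast
  ring

lemma integral_pow_div_cos_add_cosh (p : ℕ) :
    ∫ x in Ioi (0 : ℝ), x ^ (4 * p + 1) / (Real.cos x + Real.cosh x) ^ 3 =
      π / 4 * (-4) ^ p *
        ∑' m : ℕ, (-1 : ℝ) ^ m * powDivCoshAuxReal (4 * p + 1) ((2 * m + 1) * π / 2) := by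
  have h1 := im_integral_powDivCosh_ray_eq_tsum (n := 4 * p + 1) ⟨2 * p, by ring⟩
  rw [setIntegral_congr_fun measurableSet_Ioi fun x hx => powDivCosh_ray_eq p (le_of_lt hx),
    integral_mul_const, integral_complex_ofReal, integral_const_mul, Complex.im_ofReal_mul,
    Complex.I_im, mul_one] at h1
  have h2 := integral_comp_mul_left_Ioi
    (fun x : ℝ => x ^ (4 * p + 1) / (Real.cos x + Real.cosh x) ^ 3) 0 (b := 2) two_pos
  simp only [mul_pow, mul_div_assoc, mul_zero, smul_eq_mul] at h2
  rw [integral_const_mul] at h2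
  set Q := ∫ x in Ioi (0 : ℝ), x ^ (4 * p + 1) / (Real.cos (2 * x) + Real.cosh (2 * x)) ^ 3
  set S := ∑' m : ℕ, (-1 : ℝ) ^ m * powDivCoshAuxReal (4 * p + 1) ((2 * m + 1) * π / 2)
  have h3 : (2 : ℝ) ^ (4 * p + 1) = 2 * ((-4) ^ p * (-4) ^ p) := by
    rw [pow_succ, pow_mul, ← mul_pow]
    norm_num
    ring
  rw [h3] at h2
  linear_combination (-2 : ℝ) * h2 - (-4) ^ p / 4 * h1

lemma summable_alternating_pow_mul (N : ℕ) {g : ℕ → ℝ}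
    (hg : ∀ m : ℕ, |g m| ≤ 1 / Real.cosh ((2 * m + 1) * π / 2)) :
    Summable fun m : ℕ => (-1 : ℝ) ^ m * (2 * m + 1) ^ N * g m := by
  have hs : Summable fun m : ℕ => 2 * ((N + 2).factorial : ℝ) * (1 / ((m + 1 : ℕ) : ℝ) ^ 2) :=
    ((summable_nat_add_iff 1).2 (Real.summable_one_div_nat_pow.2 one_lt_two)).mul_left _
  refine hs.of_norm_bounded fun m => ?_
  have hm : (m : ℝ) + 1 ≤ 2 * m + 1 := by linarith [(Nat.cast_nonneg m : (0 : ℝ) ≤ m)]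
  have hm0 : (0 : ℝ) < m + 1 := by positivity
  have hz : 2 * (m : ℝ) + 1 ≤ (2 * m + 1) * π / 2 := by nlinarith [Real.two_le_pi]
  set z : ℝ := (2 * m + 1) * π / 2
  have hz0 : 0 ≤ z := by linarith
  have h1 := Real.pow_div_factorial_le_exp z hz0 (N + 2)
  rw [div_le_iff₀ (by positivity)] at h1
  have h2 : Real.exp z ≤ 2 * Real.cosh z := by
    rw [Real.cosh_eq]
    linarith [Real.exp_pos (-z)]
  have h3 : (2 * (m : ℝ) + 1) ^ N * (m + 1) ^ 2 ≤ 2 * (N + 2).factorial * Real.cosh z := by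
    calc (2 * (m : ℝ) + 1) ^ N * (m + 1) ^ 2 ≤ z ^ N * z ^ 2 := by
          gcongr
          linarith
      _ = z ^ (N + 2) := (pow_add _ _ _).symm
      _ ≤ Real.exp z * (N + 2).factorial := h1
      _ ≤ 2 * Real.cosh z * (N + 2).factorial := by gcongr
      _ = _ := by ring
  rw [norm_mul, norm_mul, norm_pow, norm_neg, norm_one, one_pow, one_mul, Real.norm_eq_abs,
    Real.norm_eq_abs, abs_of_nonneg (by positivity : (0 : ℝ) ≤ (2 * m + 1) ^ N)]
  calc (2 * (m : ℝ) + 1) ^ N * |g m| ≤ (2 * (m : ℝ) + 1) ^ N * (1 / Real.cosh z) := by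
        gcongr
        exact hg m
    _ ≤ _ := by
        rw [mul_one_div, mul_one_div, div_le_div_iff₀ (Real.cosh_pos z) (by positivity)]
        push_cast
        exact h3

lemma abs_one_div_cosh_pow_le {k : ℕ} (hk : k ≠ 0) (z : ℝ) :
    |1 / Real.cosh z ^ k| ≤ 1 / Real.cosh z := by
  have h1 := Real.one_le_cosh z
  rw [abs_of_pos (by positivity)]
  gcongr
  exact le_self_pow₀ h1 hk

lemma abs_sinh_div_cosh_pow_le (z : ℝ) :
    |Real.sinh z / Real.cosh z ^ 4| ≤ 1 / Real.cosh z := by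
  have h1 := Real.one_le_cosh z
  have h2 : |Real.sinh z| ≤ Real.cosh z := by
    rw [abs_le, Real.sinh_eq, Real.cosh_eq]
    constructor <;> linarith [Real.exp_pos z, Real.exp_pos (-z)]
  rw [abs_div, abs_of_pos (by positivity : (0 : ℝ) < Real.cosh z ^ 4),
    div_le_div_iff₀ (by positivity) (by positivity), one_mul]
  calc |Real.sinh z| * Real.cosh z ≤ Real.cosh z * Real.cosh z := by gcongr
    _ = Real.cosh z ^ 2 := (sq _).symm
    _ ≤ Real.cosh z ^ 4 := pow_le_pow_right₀ h1 (by norm_num)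

lemma tsum_powDivCoshAuxReal (n : ℕ) :
    ∑' m : ℕ, (-1 : ℝ) ^ m * powDivCoshAuxReal n ((2 * m + 1) * π / 2) =
      (n * (n - 1 : ℕ) * (π / 2) ^ (n - 1 - 1) *
          (∑' m : ℕ, (-1 : ℝ) ^ m * (2 * m + 1) ^ (n - 1 - 1) *
            (1 / Real.cosh ((2 * m + 1) * π / 2) ^ 3))
        - 6 * n * (π / 2) ^ (n - 1) *
          (∑' m : ℕ, (-1 : ℝ) ^ m * (2 * m + 1) ^ (n - 1) *
            (Real.sinh ((2 * m + 1) * π / 2) / Real.cosh ((2 * m + 1) * π / 2) ^ 4))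
        + (π / 2) ^ n * (10 * (∑' m : ℕ, (-1 : ℝ) ^ m * (2 * m + 1) ^ n *
            (1 / Real.cosh ((2 * m + 1) * π / 2) ^ 3))
          - 12 * (∑' m : ℕ, (-1 : ℝ) ^ m * (2 * m + 1) ^ n *
            (1 / Real.cosh ((2 * m + 1) * π / 2) ^ 5)))) / 2 := by
  have hs1 := (summable_alternating_pow_mul (n - 1 - 1)
    fun m => abs_one_div_cosh_pow_le three_ne_zero ((2 * m + 1) * π / 2)).hasSum
  have hs2 := (summable_alternating_pow_mul (n - 1)
    fun m => abs_sinh_div_cosh_pow_le ((2 * m + 1) * π / 2)).hasSum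
  have hs3 := (summable_alternating_pow_mul n
    fun m => abs_one_div_cosh_pow_le three_ne_zero ((2 * m + 1) * π / 2)).hasSum
  have hs4 := (summable_alternating_pow_mul n
    fun m => abs_one_div_cosh_pow_le (k := 5) (by norm_num) ((2 * m + 1) * π / 2)).hasSum
  have h := (((hs1.mul_left (n * (n - 1 : ℕ) * (π / 2) ^ (n - 1 - 1))).sub
    (hs2.mul_left (6 * n * (π / 2) ^ (n - 1)))).add
    (((hs3.mul_left 10).sub (hs4.mul_left 12)).mul_left ((π / 2) ^ n))).div_const 2
  rw [← h.tsum_eq]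
  refine tsum_congr fun m => ?_
  rw [powDivCoshAuxReal, mul_div_assoc (2 * (m : ℝ) + 1), mul_pow, mul_pow, mul_pow]
  ring

theorem cor_cos_plus_cosh (p : ℕ) :
    ((-4 : ℝ) ^ (p+1) / π ^ (4*p)) *
      (∫ x in Set.Ioi (0:ℝ), x ^ (4*p+1) / (Real.cos x + Real.cosh x) ^ 3) =
    4 * (p : ℝ) * (4 * (p : ℝ) + 1) *
        (∑' n : ℕ, (-1 : ℝ) ^ (n+1) * (2*(n:ℝ)+1) ^ (4*(p:ℝ) - 1)
            / Real.cosh ((2*(n:ℝ)+1) * π / 2) ^ 3)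
    + (5 * π ^ 2 / 2) *
        (∑' n : ℕ, (-1 : ℝ) ^ (n+1) * (2*(n:ℝ)+1) ^ (4*p+1)
            / Real.cosh ((2*(n:ℝ)+1) * π / 2) ^ 3)
    - 3 * (4 * (p : ℝ) + 1) * π *
        (∑' n : ℕ, (-1 : ℝ) ^ (n+1) * (2*(n:ℝ)+1) ^ (4*p)
            * Real.sinh ((2*(n:ℝ)+1) * π / 2) / Real.cosh ((2*(n:ℝ)+1) * π / 2) ^ 4)
    - 3 * π ^ 2 *
        (∑' n : ℕ, (-1 : ℝ) ^ (n+1) * (2*(n:ℝ)+1) ^ (4*p+1)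
            / Real.cosh ((2*(n:ℝ)+1) * π / 2) ^ 5) := by
  rw [integral_pow_div_cos_add_cosh, tsum_powDivCoshAuxReal]
  simp only [Nat.add_sub_cancel]
  have e2 : ∑' n : ℕ, (-1 : ℝ) ^ (n+1) * (2*(n:ℝ)+1) ^ (4*p+1)
      / Real.cosh ((2*(n:ℝ)+1) * π / 2) ^ 3 =
      -∑' m : ℕ, (-1 : ℝ) ^ m * (2 * m + 1) ^ (4 * p + 1) *
        (1 / Real.cosh ((2 * m + 1) * π / 2) ^ 3) := by
    rw [← tsum_neg]
    exact tsum_congr fun m => by ring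
  have e3 : ∑' n : ℕ, (-1 : ℝ) ^ (n+1) * (2*(n:ℝ)+1) ^ (4*p)
      * Real.sinh ((2*(n:ℝ)+1) * π / 2) / Real.cosh ((2*(n:ℝ)+1) * π / 2) ^ 4 =
      -∑' m : ℕ, (-1 : ℝ) ^ m * (2 * m + 1) ^ (4 * p) *
        (Real.sinh ((2 * m + 1) * π / 2) / Real.cosh ((2 * m + 1) * π / 2) ^ 4) := by
    rw [← tsum_neg]
    exact tsum_congr fun m => by ring
  have e4 : ∑' n : ℕ, (-1 : ℝ) ^ (n+1) * (2*(n:ℝ)+1) ^ (4*p+1)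
      / Real.cosh ((2*(n:ℝ)+1) * π / 2) ^ 5 =
      -∑' m : ℕ, (-1 : ℝ) ^ m * (2 * m + 1) ^ (4 * p + 1) *
        (1 / Real.cosh ((2 * m + 1) * π / 2) ^ 5) := by
    rw [← tsum_neg]
    exact tsum_congr fun m => by ring
  have e1 : (p : ℝ) * (∑' n : ℕ, (-1 : ℝ) ^ (n+1) * (2*(n:ℝ)+1) ^ (4*(p:ℝ) - 1)
      / Real.cosh ((2*(n:ℝ)+1) * π / 2) ^ 3) =
      (p : ℝ) * -∑' m : ℕ, (-1 : ℝ) ^ m * (2 * m + 1) ^ (4 * p - 1) *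
        (1 / Real.cosh ((2 * m + 1) * π / 2) ^ 3) := by
    rcases p with _ | q
    · simp
    rw [← tsum_neg]
    congr 1
    refine tsum_congr fun m => ?_
    have : 4 * ((q + 1 : ℕ) : ℝ) - 1 = ((4 * (q + 1) - 1 : ℕ) : ℝ) := by
      rw [Nat.cast_sub (by omega)]
      push_cast
      ring
    rw [this, Real.rpow_natCast]
    ring
  have e0 : ∀ T : ℝ, 4 * (p : ℝ) * (4 * p + 1) * T = 4 * (4 * p + 1) * (p * T) := fun T => by ring
  rw [e0, e1, e2, e3, e4]
  set A1 := ∑' m : ℕ, (-1 : ℝ) ^ m * (2 * m + 1) ^ (4 * p - 1) *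
        (1 / Real.cosh ((2 * m + 1) * π / 2) ^ 3)
  set A2 := ∑' m : ℕ, (-1 : ℝ) ^ m * (2 * m + 1) ^ (4 * p + 1) *
        (1 / Real.cosh ((2 * m + 1) * π / 2) ^ 3)
  set A3 := ∑' m : ℕ, (-1 : ℝ) ^ m * (2 * m + 1) ^ (4 * p) *
        (Real.sinh ((2 * m + 1) * π / 2) / Real.cosh ((2 * m + 1) * π / 2) ^ 4)
  set A4 := ∑' m : ℕ, (-1 : ℝ) ^ m * (2 * m + 1) ^ (4 * p + 1) *
        (1 / Real.cosh ((2 * m + 1) * π / 2) ^ 5)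
  have h16 : ((-4 : ℝ) ^ p) ^ 2 = 2 ^ (4 * p) := by
    rw [← pow_mul, mul_comm p, pow_mul, pow_mul]
    norm_num
  have hp1 : (p : ℝ) * (π / 2) ^ (4 * p - 1) = p * ((π / 2) ^ (4 * p) * (2 / π)) := by
    rcases p with _ | q
    · simp
    · rw [show 4 * (q + 1) = 4 * (q + 1) - 1 + 1 by omega, pow_succ, Nat.add_sub_cancel]
      have := Real.pi_ne_zero
      field_simp
  have hpi := Real.pi_ne_zero
  have hP : (π / 2) ^ (4 * p) = π ^ (4 * p) / ((-4 : ℝ) ^ p) ^ 2 := by rw [h16, div_pow]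
  have hL : (((4 * p + 1 : ℕ) : ℝ) * ((4 * p : ℕ) : ℝ) * (π / 2) ^ (4 * p - 1) * A1
      - 6 * ((4 * p + 1 : ℕ) : ℝ) * (π / 2) ^ (4 * p) * A3
      + (π / 2) ^ (4 * p + 1) * (10 * A2 - 12 * A4)) =
      π ^ (4 * p) / ((-4 : ℝ) ^ p) ^ 2 * ((4 * p + 1) * (4 * p) * (2 / π) * A1
        - 6 * (4 * p + 1) * A3 + π / 2 * (10 * A2 - 12 * A4)) := by
    rw [pow_succ, hP]
    rw [hP] at hp1
    push_cast
    linear_combination (4 * p + 1) * 4 * A1 * hp1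
  rw [hL, pow_succ]
  have h4 : ((-4 : ℝ)) ^ p ≠ 0 := pow_ne_zero _ (by norm_num)
  have hpp : π ^ (4 * p) ≠ 0 := pow_ne_zero _ hpi
  field_simp
  ring
end

section
/- For every integer p ≥ 2: ((−1)^(p−1)/(π^(4p−2)·2^(2p−3))) · ∫_0^∞ x^(4p−1)/(cos x − cosh x)^3 dx = −((4p−1)(4p−2)/2)·Σ_{n=1}^∞ (−1)^n n^(4p−3)/sinh(nπ)^3 + 3(4p−1)π·Σ_{n=1}^∞ (−1)^n n^(4p−2) cosh(nπ)/sinh(nπ)^4 − 5π²·Σ_{n=1}^∞ (−1)^n n^(4p−1)/sinh(nπ)^3 − 6π²·Σ_{n=1}^∞ (−1)^n n^(4p−1)/sinh(nπ)^5. -/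
open Real

open MeasureTheory Filter Topology

lemma integrableOn_pow_mul_cexp_neg_mul (k : ℕ) {r : ℂ} (hr : 0 < r.re) :
    IntegrableOn (fun x : ℝ => (x : ℂ) ^ k * Complex.exp (-(r * x))) (Set.Ioi 0) := by
  have h := integrableOn_rpow_mul_exp_neg_mul_rpow (p := 1) (s := k) (b := r.re)
    (by linarith [(Nat.cast_nonneg k : (0 : ℝ) ≤ k)]) one_pos hr
  refine Integrable.mono' h (by fun_prop) ?_
  filter_upwards [ae_restrict_mem measurableSet_Ioi] with x hx
  have hx : 0 < x := hx
  simp [Complex.norm_exp, abs_of_pos hx]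

lemma integral_pow_mul_cexp_neg_mul (k : ℕ) {r : ℂ} (hr : 0 < r.re) :
    ∫ x : ℝ in Set.Ioi 0, (x : ℂ) ^ k * Complex.exp (-(r * x)) =
      (k.factorial : ℂ) / r ^ (k + 1) := by
  have hr0 : r ≠ 0 := by rintro rfl; simp at hr
  have hlim (n : ℕ) : Tendsto (fun x : ℝ => (x : ℂ) ^ n * Complex.exp (-(r * x))) atTop (𝓝 0) := by
    rw [tendsto_zero_iff_norm_tendsto_zero]
    have h := tendsto_rpow_mul_exp_neg_mul_atTop_nhds_zero (n : ℝ) r.re hr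
    refine h.congr' ?_
    filter_upwards [eventually_gt_atTop 0] with x hx
    simp [Complex.norm_exp, abs_of_pos hx]
  have hexp (x : ℝ) : HasDerivAt (fun x : ℝ => Complex.exp (-(r * x)))
      (Complex.exp (-(r * x)) * (-r)) x := by
    have h1 : HasDerivAt (fun x : ℝ => -(r * (x : ℂ))) (-r) x := by
      convert! ((hasDerivAt_id x).ofReal_comp.const_mul r).neg using 1
      simp
    exact h1.cexp
  induction k with
  | zero =>
    have h := integral_Ioi_of_hasDerivAt_of_tendsto' (a := 0) (fun x _ => hexp x)
      (by
        refine Integrable.mul_const ?_ (-r)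
        simpa [IntegrableOn] using integrableOn_pow_mul_cexp_neg_mul 0 hr)
      (by simpa using hlim 0)
    rw [integral_mul_const] at h
    simp only [pow_zero, one_mul, Nat.factorial_zero, Nat.cast_one, zero_add, pow_one]
    rw [eq_div_iff hr0]
    simp at h
    linear_combination h
  | succ k ih =>
    have hd (x : ℝ) : HasDerivAt (fun x : ℝ => (x : ℂ) ^ (k + 1) * Complex.exp (-(r * x)))
        (((k : ℂ) + 1) * ((x : ℂ) ^ k * Complex.exp (-(r * x)))
          - r * ((x : ℂ) ^ (k + 1) * Complex.exp (-(r * x)))) x := by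
      have h1 := ((hasDerivAt_id x).ofReal_comp.pow (k + 1)).mul (hexp x)
      refine h1.congr_deriv ?_
      simp
      ring
    have i1 := (integrableOn_pow_mul_cexp_neg_mul k hr).const_mul ((k : ℂ) + 1)
    have i2 := (integrableOn_pow_mul_cexp_neg_mul (k + 1) hr).const_mul r
    have h := integral_Ioi_of_hasDerivAt_of_tendsto' (a := 0) (fun x _ => hd x) (i1.sub i2)
      (hlim (k + 1))
    rw [integral_sub i1 i2, integral_const_mul, integral_const_mul, ih] at h
    simp at h
    have h2 : ∫ x : ℝ in Set.Ioi 0, (x : ℂ) ^ (k + 1) * Complex.exp (-(r * x)) =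
       ((k : ℂ) + 1) * (k.factorial / r ^ (k + 1)) / r := by
      rw [eq_div_iff hr0]
      linear_combination -h
    rw [h2, Nat.factorial_succ]
    push_cast
    field_simp
    ring

lemma one_sub_sq_ne_zero {y : ℂ} (hy : ‖y‖ < 1) : 1 - y ^ 2 ≠ 0 := by
  intro h
  have hy2 : ‖y ^ 2‖ < 1 := by rw [norm_pow]; nlinarith [norm_nonneg y]
  rw [sub_eq_zero.1 h |>.symm] at hy2
  simp at hy2

lemma hasSum_choose_mul_pow_odd {y : ℂ} (hy : ‖y‖ < 1) :
    HasSum (fun j : ℕ => ((j + 1).choose 2 : ℂ) * y ^ (2 * j + 1)) (y ^ 3 / (1 - y ^ 2) ^ 3) := by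
  have hy2 : ‖y ^ 2‖ < 1 := by rw [norm_pow]; nlinarith [norm_nonneg y]
  rw [← hasSum_nat_add_iff' 1]
  have h := (hasSum_choose_mul_geometric_of_norm_lt_one 2 hy2).mul_left (y ^ 3)
  convert! h using 1
  · ext j
    rw [show j + 1 + 1 = j + 2 by ring]
    ring
  · simp; ring

lemma choose_two_mul_odd (j : ℕ) : (((j + 2).choose 2 : ℕ) : ℂ) * (2 * j + 3) =
    6 * (j + 3).choose 3 - 3 * (j + 2).choose 2 := by
  have := Nat.add_one_mul_choose_eq (j + 2) 2
  have h : ((j : ℂ) + 3) * (j + 2).choose 2 = (j + 3).choose 3 * 3 := by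
    exact_mod_cast this
  linear_combination 2 * h

lemma choose_two_mul_odd_sq (j : ℕ) : (((j + 2).choose 2 : ℕ) : ℂ) * (2 * j + 3) ^ 2 =
    48 * (j + 4).choose 4 - 48 * (j + 3).choose 3 + 9 * (j + 2).choose 2 := by
  have := Nat.add_one_mul_choose_eq (j + 3) 3
  have h : ((j : ℂ) + 4) * (j + 3).choose 3 = (j + 4).choose 4 * 4 := by
    exact_mod_cast this
  linear_combination 12 * h + (2 * j + 3) * choose_two_mul_odd j - 3 * choose_two_mul_odd j

lemma hasSum_choose_mul_odd_mul_pow_odd {y : ℂ} (hy : ‖y‖ < 1) :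
    HasSum (fun j : ℕ => ((j + 1).choose 2 : ℂ) * (2 * j + 1) * y ^ (2 * j + 1))
      (3 * y ^ 3 * (1 + y ^ 2) / (1 - y ^ 2) ^ 4) := by
  have hy2 : ‖y ^ 2‖ < 1 := by rw [norm_pow]; nlinarith [norm_nonneg y]
  have hne := one_sub_sq_ne_zero hy
  rw [← hasSum_nat_add_iff' 1]
  have h := (((hasSum_choose_mul_geometric_of_norm_lt_one 3 hy2).mul_left 6).sub
    ((hasSum_choose_mul_geometric_of_norm_lt_one 2 hy2).mul_left 3)).mul_left (y ^ 3)
  convert! h using 1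
  · ext j
    rw [show j + 1 + 1 = j + 2 by ring]
    push_cast
    linear_combination y ^ (2 * (j + 1) + 1) * choose_two_mul_odd j
  · simp; field_simp; ring

lemma hasSum_choose_mul_odd_sq_mul_pow_odd {y : ℂ} (hy : ‖y‖ < 1) :
    HasSum (fun j : ℕ => ((j + 1).choose 2 : ℂ) * (2 * j + 1) ^ 2 * y ^ (2 * j + 1))
      (y ^ 3 * (9 + 30 * y ^ 2 + 9 * y ^ 4) / (1 - y ^ 2) ^ 5) := by
  have hy2 : ‖y ^ 2‖ < 1 := by rw [norm_pow]; nlinarith [norm_nonneg y]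
  have hne := one_sub_sq_ne_zero hy
  rw [← hasSum_nat_add_iff' 1]
  have h := ((((hasSum_choose_mul_geometric_of_norm_lt_one 4 hy2).mul_left 48).sub
    ((hasSum_choose_mul_geometric_of_norm_lt_one 3 hy2).mul_left 48)).add
    ((hasSum_choose_mul_geometric_of_norm_lt_one 2 hy2).mul_left 9)).mul_left (y ^ 3)
  convert! h using 1
  · ext j
    rw [show j + 1 + 1 = j + 2 by ring]
    push_cast
    linear_combination y ^ (2 * (j + 1) + 1) * choose_two_mul_odd_sq j
  · simp; field_simp; ring

lemma sinh_eq_exp_neg (u : ℂ) : Complex.sinh u =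
    (1 - Complex.exp (-u) ^ 2) / (2 * Complex.exp (-u)) := by
  rw [Complex.sinh, Complex.exp_neg]
  field_simp [Complex.exp_ne_zero u]

lemma cosh_eq_exp_neg (u : ℂ) : Complex.cosh u =
    (1 + Complex.exp (-u) ^ 2) / (2 * Complex.exp (-u)) := by
  rw [Complex.cosh, Complex.exp_neg]
  field_simp [Complex.exp_ne_zero u]

lemma norm_cexp_neg_lt_one {u : ℂ} (hu : 0 < u.re) : ‖Complex.exp (-u)‖ < 1 := by
  simpa [Complex.norm_exp] using hu

lemma hasSum_one_div_sinh_cube {u : ℂ} (hu : 0 < u.re) :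
    HasSum (fun j : ℕ => ((j + 1).choose 2 : ℂ) * Complex.exp (-u) ^ (2 * j + 1))
      (1 / (8 * Complex.sinh u ^ 3)) := by
  convert! hasSum_choose_mul_pow_odd (norm_cexp_neg_lt_one hu) using 1
  have := Complex.exp_ne_zero (-u)
  rw [sinh_eq_exp_neg]
  field_simp
  norm_num

lemma hasSum_cosh_div_sinh_pow_four {u : ℂ} (hu : 0 < u.re) :
    HasSum (fun j : ℕ => ((j + 1).choose 2 : ℂ) * (2 * j + 1) * Complex.exp (-u) ^ (2 * j + 1))
      (3 * Complex.cosh u / (8 * Complex.sinh u ^ 4)) := by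
  convert! hasSum_choose_mul_odd_mul_pow_odd (norm_cexp_neg_lt_one hu) using 1
  have := Complex.exp_ne_zero (-u)
  rw [sinh_eq_exp_neg, cosh_eq_exp_neg]
  field_simp
  norm_num

lemma hasSum_nine_div_sinh_cube_add_twelve_div_sinh_pow_five {u : ℂ} (hu : 0 < u.re) :
    HasSum (fun j : ℕ => ((j + 1).choose 2 : ℂ) * (2 * j + 1) ^ 2 *
        Complex.exp (-u) ^ (2 * j + 1))
      (9 / (8 * Complex.sinh u ^ 3) + 12 / (8 * Complex.sinh u ^ 5)) := by
  convert! hasSum_choose_mul_odd_sq_mul_pow_odd (norm_cexp_neg_lt_one hu) using 1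
  have := Complex.exp_ne_zero (-u)
  have := one_sub_sq_ne_zero (norm_cexp_neg_lt_one hu)
  rw [sinh_eq_exp_neg]
  field_simp
  ring

lemma hasSum_one_div_sub_odd_mul_I_pow {t : ℝ} (ht : 0 < t) {k : ℕ} (hk : 1 ≤ k) :
    HasSum (fun l : ℤ => 1 / ((t : ℂ) - (2 * l + 1) * Complex.I) ^ (k + 1))
      ((π : ℂ) ^ (k + 1) / k.factorial * ∑' r : ℕ, (-1 : ℂ) ^ (r + 1) * ((r : ℂ) + 1) ^ k *
        Complex.exp (-(((r : ℂ) + 1) * π * t))) := by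
  let z : UpperHalfPlane := ⟨(1 + t * Complex.I) / 2, by simpa using ht⟩
  have hz : (z : ℂ) = (1 + t * Complex.I) / 2 := rfl
  have hterm (l : ℤ) : 1 / ((t : ℂ) - (2 * l + 1) * Complex.I) ^ (k + 1) =
      (Complex.I / 2) ^ (k + 1) * (1 / ((z : ℂ) + l) ^ (k + 1)) := by
    have h1 : (z : ℂ) + l = Complex.I / 2 * ((t : ℂ) - (2 * l + 1) * Complex.I) := by
      rw [hz]
      linear_combination ((2 * (l : ℂ) + 1) / 2) * Complex.I_sq
    rw [h1, mul_pow]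
    have : (Complex.I / 2) ^ (k + 1) ≠ 0 := by simp
    field_simp
  have hsum : Summable (fun l : ℤ => 1 / ((z : ℂ) + l) ^ (k + 1)) := by
    have := EisensteinSeries.linear_right_summable (z : ℂ) 1 (k := k + 1) (by omega)
    refine this.congr fun l => ?_
    rw [show ((k : ℤ) + 1) = ((k + 1 : ℕ) : ℤ) by simp, zpow_natCast]
    simp
  have h := (hsum.hasSum.mul_left ((Complex.I / 2) ^ (k + 1)))
  simp_rw [← hterm] at h
  convert! h using 1
  rw [EisensteinSeries.qExpansion_identity_pnat hk z, tsum_pnat_eq_tsum_succ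
    (f := fun n : ℕ => (n : ℂ) ^ k * Complex.exp (2 * π * Complex.I * z) ^ n), ← mul_assoc,
    mul_div_assoc', ← mul_pow]
  congr 1
  · congr 2
    linear_combination (π : ℂ) * Complex.I_sq
  · refine tsum_congr fun r => ?_
    rw [← Complex.exp_nat_mul, hz,
      show ((r + 1 : ℕ) : ℂ) * (2 * π * Complex.I * ((1 + t * Complex.I) / 2)) =
        ((r + 1 : ℕ) : ℂ) * (π * Complex.I) + -(((r : ℂ) + 1) * π * t) by
          push_cast
          linear_combination ((r : ℂ) + 1) * π * t * Complex.I_sq,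
      Complex.exp_add, Complex.exp_nat_mul, Complex.exp_pi_mul_I]
    push_cast
    ring

/-- The alternating Lambert-type sum `∑_{r ≥ 1} (-1)^r r^k exp(-r π t)`. -/
noncomputable def altExpSum (k : ℕ) (t : ℝ) : ℂ :=
  ∑' r : ℕ, (-1 : ℂ) ^ (r + 1) * ((r : ℂ) + 1) ^ k * Complex.exp (-(((r : ℂ) + 1) * π * t))

lemma natCast_choose_succ_two (m : ℕ) : ((m + 1).choose 2 : ℂ) = (m + 1) * m / 2 := by
  rw [Nat.cast_choose_two]; push_cast; ring

lemma ofReal_sub_mul_I_ne_zero {t : ℝ} (ht : 0 < t) (m : ℝ) : (t : ℂ) - m * Complex.I ≠ 0 := by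
  intro h
  have := congrArg Complex.re h
  simp at this
  exact ht.ne' this

lemma hasSum_choose_mul_inv_pow {t : ℝ} (ht : 0 < t) {k : ℕ} (hk : 1 ≤ k) :
    HasSum (fun m : ℕ => ((m + 1).choose 2 : ℂ) *
        (1 / ((t : ℂ) + (2 * m + 1) * Complex.I) ^ (k + 3) +
          1 / ((t : ℂ) - (2 * m + 1) * Complex.I) ^ (k + 3)))
      (1 / 8 * (-(π : ℂ) ^ (k + 1) / k.factorial * altExpSum k t
        + 2 * t * (π ^ (k + 2) / (k + 1).factorial) * altExpSum (k + 1) t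
        - (t ^ 2 + 1) * (π ^ (k + 3) / (k + 2).factorial) * altExpSum (k + 2) t)) := by
  have h1 := hasSum_one_div_sub_odd_mul_I_pow ht hk
  have h2 := hasSum_one_div_sub_odd_mul_I_pow ht (k := k + 1) (by omega)
  have h3 := hasSum_one_div_sub_odd_mul_I_pow ht (k := k + 2) (by omega)
  have h := (((h1.neg.add (h2.mul_left (2 * (t : ℂ)))).sub
    (h3.mul_left ((t : ℂ) ^ 2 + 1))).mul_left (1 / 8)).nat_add_neg_add_one
  have key (l : ℤ) : (1 / 8 : ℂ) * (-(1 / ((t : ℂ) - (2 * l + 1) * Complex.I) ^ (k + 1))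
      + 2 * t * (1 / ((t : ℂ) - (2 * l + 1) * Complex.I) ^ (k + 1 + 1))
      - (t ^ 2 + 1) * (1 / ((t : ℂ) - (2 * l + 1) * Complex.I) ^ (k + 2 + 1))) =
      (l + 1) * l / 2 * (1 / ((t : ℂ) - (2 * l + 1) * Complex.I) ^ (k + 3)) := by
    have hne := ofReal_sub_mul_I_ne_zero ht (2 * l + 1)
    push_cast at hne
    set q : ℂ := (t : ℂ) - (2 * l + 1) * Complex.I with hq
    have q1 : 1 / q ^ (k + 1) = q ^ 2 * (1 / q ^ (k + 3)) := by field_simp; ring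
    have q2 : 1 / q ^ (k + 1 + 1) = q * (1 / q ^ (k + 3)) := by field_simp; ring
    rw [q1, q2]
    generalize 1 / q ^ (k + 3) = w
    rw [hq]
    linear_combination (-(2 * (l : ℂ) + 1) ^ 2 / 8 * w) * Complex.I_sq
  simp only [key] at h
  convert! h using 1
  · ext m
    rw [natCast_choose_succ_two]
    push_cast
    ring_nf
  · simp only [altExpSum]
    ring

lemma summable_two_mul_add_two_pow_mul_geometric (s : ℕ) {ρ : ℝ} (h0 : 0 < ρ) (h1 : ρ < 1) :
    Summable (fun j : ℕ => (2 * (j : ℝ) + 2) ^ s * ρ ^ j) := by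
  have h := (summable_nat_add_iff 1).2 (summable_pow_mul_geometric_of_norm_lt_one s
    (r := ρ) (by rwa [Real.norm_of_nonneg h0.le]))
  refine (h.mul_left (2 ^ s / ρ)).congr fun j => ?_
  push_cast
  rw [show 2 * (j : ℝ) + 2 = 2 * (j + 1) by ring, mul_pow, pow_succ]
  field_simp

lemma norm_choose_succ_two_le (j : ℕ) : ‖((j + 1).choose 2 : ℂ)‖ ≤ (2 * (j : ℝ) + 2) ^ 2 := by
  rw [Complex.norm_natCast, Nat.cast_choose_two]
  push_cast
  nlinarith [(Nat.cast_nonneg j : (0 : ℝ) ≤ j)]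

lemma summable_choose_mul_altExp (s k : ℕ) :
    Summable (fun x : ℕ × ℕ => ((x.1 + 1).choose 2 : ℂ) * (2 * x.1 + 1) ^ s *
      ((-1 : ℂ) ^ (x.2 + 1) * ((x.2 : ℂ) + 1) ^ k *
        Complex.exp (-(((x.2 : ℂ) + 1) * π * ((2 * x.1 + 1 : ℝ) : ℂ))))) := by
  have hρ : Real.exp (-π) < 1 := by simpa using Real.pi_pos
  have h := (summable_two_mul_add_two_pow_mul_geometric (2 + s) (Real.exp_pos (-π)) hρ).mul_of_nonneg
    (summable_two_mul_add_two_pow_mul_geometric k (Real.exp_pos (-π)) hρ)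
    (fun j => by positivity) (fun j => by positivity)
  refine Summable.of_norm_bounded h fun x => ?_
  obtain ⟨j, r⟩ := x
  have e1 : ‖(2 * (j : ℂ) + 1)‖ ≤ 2 * (j : ℝ) + 2 := by
    rw [show (2 * (j : ℂ) + 1) = ((2 * j + 1 : ℕ) : ℂ) by push_cast; ring, Complex.norm_natCast]
    push_cast; linarith
  have e2 : ‖((r : ℂ) + 1)‖ ≤ 2 * (r : ℝ) + 2 := by
    rw [show ((r : ℂ) + 1) = ((r + 1 : ℕ) : ℂ) by push_cast; ring, Complex.norm_natCast]
    push_cast; linarith [(Nat.cast_nonneg r : (0 : ℝ) ≤ r)]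
  have e3 : ‖Complex.exp (-(((r : ℂ) + 1) * π * ((2 * j + 1 : ℝ) : ℂ)))‖ ≤
      Real.exp (-π) ^ j * Real.exp (-π) ^ r := by
    rw [show -(((r : ℂ) + 1) * π * ((2 * j + 1 : ℝ) : ℂ)) =
      ((-(((r : ℝ) + 1) * π * (2 * j + 1)) : ℝ) : ℂ) by push_cast; ring,
      Complex.norm_exp_ofReal, ← pow_add, ← Real.exp_nat_mul]
    refine Real.exp_le_exp.2 ?_
    push_cast
    have : (0 : ℝ) ≤ π * (j + 2 * r * j + 1) := by positivity
    nlinarith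
  simp only [norm_mul, norm_pow, norm_neg, norm_one, one_pow, one_mul]
  calc _ ≤ (2 * (j : ℝ) + 2) ^ 2 * (2 * (j : ℝ) + 2) ^ s *
        ((2 * (r : ℝ) + 2) ^ k * (Real.exp (-π) ^ j * Real.exp (-π) ^ r)) := by
        gcongr
        exact norm_choose_succ_two_le j
    _ = _ := by ring

lemma cexp_neg_mul_odd (r j : ℕ) :
    Complex.exp (-(((r : ℂ) + 1) * π * ((2 * j + 1 : ℝ) : ℂ))) =
      Complex.exp (-(((r : ℂ) + 1) * π)) ^ (2 * j + 1) := by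
  rw [← Complex.exp_nat_mul]
  congr 1
  push_cast
  ring

lemma hasSum_choose_mul_altExpSum {s : ℕ} (k : ℕ) {g : ℂ → ℂ}
    (hg : ∀ u : ℂ, 0 < u.re → HasSum (fun j : ℕ => ((j + 1).choose 2 : ℂ) * (2 * j + 1) ^ s *
      Complex.exp (-u) ^ (2 * j + 1)) (g u)) :
    Summable (fun r : ℕ => (-1 : ℂ) ^ (r + 1) * ((r : ℂ) + 1) ^ k * g (((r : ℂ) + 1) * π)) ∧
    HasSum (fun j : ℕ => ((j + 1).choose 2 : ℂ) * (2 * j + 1) ^ s * altExpSum k (2 * j + 1))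
      (∑' r : ℕ, (-1 : ℂ) ^ (r + 1) * ((r : ℂ) + 1) ^ k * g (((r : ℂ) + 1) * π)) := by
  have hs := summable_choose_mul_altExp s k
  have hr (r : ℕ) : ∑' j : ℕ, ((j + 1).choose 2 : ℂ) * (2 * j + 1) ^ s *
      ((-1 : ℂ) ^ (r + 1) * ((r : ℂ) + 1) ^ k *
        Complex.exp (-(((r : ℂ) + 1) * π * ((2 * j + 1 : ℝ) : ℂ)))) =
      (-1 : ℂ) ^ (r + 1) * ((r : ℂ) + 1) ^ k * g (((r : ℂ) + 1) * π) := by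
    have hre : 0 < (((r : ℂ) + 1) * π).re := by
      rw [show ((r : ℂ) + 1) * π = ((((r : ℝ) + 1) * π : ℝ) : ℂ) by push_cast; ring,
        Complex.ofReal_re]
      positivity
    rw [← (hg _ hre).tsum_eq, ← tsum_mul_left]
    refine tsum_congr fun j => ?_
    rw [cexp_neg_mul_odd]
    ring
  refine ⟨hs.prod_symm.prod.congr hr, ?_⟩
  have h1 := hs.prod.hasSum
  convert! h1 using 1
  · ext j
    exact tsum_mul_left.symm
  · exact Eq.trans (tsum_congr fun r => (hr r).symm) (Summable.tsum_comm (f := fun j r : ℕ =>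
      ((j + 1).choose 2 : ℂ) * (2 * j + 1) ^ s * ((-1 : ℂ) ^ (r + 1) * ((r : ℂ) + 1) ^ k *
        Complex.exp (-(((r : ℂ) + 1) * π * ((2 * j + 1 : ℝ) : ℂ))))) hs)

lemma cos_sub_cosh_eq (x : ℝ) : ((Real.cos x - Real.cosh x : ℝ) : ℂ) =
    -2 * (Complex.sinh ((1 - Complex.I) / 2 * x) * Complex.sinh ((1 + Complex.I) / 2 * x)) := by
  have h1 := Complex.cosh_add ((1 - Complex.I) / 2 * x) ((1 + Complex.I) / 2 * x)
  have h2 := Complex.cosh_sub ((1 + Complex.I) / 2 * x) ((1 - Complex.I) / 2 * x)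
  rw [show (1 - Complex.I) / 2 * (x : ℂ) + (1 + Complex.I) / 2 * x = x by ring] at h1
  rw [show (1 + Complex.I) / 2 * (x : ℂ) - (1 - Complex.I) / 2 * x = x * Complex.I by ring,
    Complex.cosh_mul_I] at h2
  push_cast
  linear_combination h2 - h1

lemma mul_odd_add_mul_odd (j k : ℕ) : (2 * (j : ℂ) + 1) * ((1 - Complex.I) / 2) +
    (2 * k + 1) * ((1 + Complex.I) / 2) =
      (1 - Complex.I) / 2 * (2 * j + 1 + (2 * k + 1) * Complex.I) := by
  linear_combination (2 * (k : ℂ) + 1) / 2 * Complex.I_sq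

lemma half_one_sub_I_mul_re (j k : ℕ) :
    ((1 - Complex.I) / 2 * (2 * j + 1 + (2 * k + 1) * Complex.I)).re = j + k + 1 := by
  rw [show (1 - Complex.I) / 2 * (2 * j + 1 + (2 * k + 1) * Complex.I) =
    ((j + k + 1 : ℝ) : ℂ) + ((k - j : ℝ) : ℂ) * Complex.I by
      push_cast
      linear_combination -(2 * (k : ℂ) + 1) / 2 * Complex.I_sq]
  simp

lemma half_one_sub_I_mul_re_pos (j k : ℕ) :
    0 < ((1 - Complex.I) / 2 * (2 * j + 1 + (2 * k + 1) * Complex.I)).re := by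
  rw [half_one_sub_I_mul_re]; positivity

/-- The summands of the double exponential expansion of `-y ^ N / (8 (cos y - cosh y) ^ 3)`. -/
noncomputable def expTerm (N : ℕ) (x : ℕ × ℕ) (y : ℝ) : ℂ :=
  ((x.1 + 1).choose 2 : ℂ) * ((x.2 + 1).choose 2 : ℂ) * ((y : ℂ) ^ N * Complex.exp
    (-((1 - Complex.I) / 2 * (2 * x.1 + 1 + (2 * x.2 + 1) * Complex.I) * y)))

lemma tsum_expTerm (N : ℕ) {y : ℝ} (hy : 0 < y) :
    ∑' x, expTerm N x y = ((-1 / 8 * (y ^ N / (Real.cos y - Real.cosh y) ^ 3) : ℝ) : ℂ) := by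
  have ha : 0 < ((1 - Complex.I) / 2 * y).re := by simp; positivity
  have hb : 0 < ((1 + Complex.I) / 2 * y).re := by simp; positivity
  have h1 := hasSum_one_div_sinh_cube ha
  have h2 := hasSum_one_div_sinh_cube hb
  have h := tsum_mul_tsum_of_summable_norm h1.summable.norm h2.summable.norm
  rw [h1.tsum_eq, h2.tsum_eq] at h
  have e : ∀ x, expTerm N x y = (y : ℂ) ^ N * (
      ((x.1 + 1).choose 2 * Complex.exp (-((1 - Complex.I) / 2 * y)) ^ (2 * x.1 + 1)) *
      ((x.2 + 1).choose 2 * Complex.exp (-((1 + Complex.I) / 2 * y)) ^ (2 * x.2 + 1))) := by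
    intro x
    rw [expTerm, ← mul_odd_add_mul_odd, ← Complex.exp_nat_mul, ← Complex.exp_nat_mul,
      show -(((2 * (x.1 : ℂ) + 1) * ((1 - Complex.I) / 2) + (2 * x.2 + 1) *
        ((1 + Complex.I) / 2)) * y) = ((2 * x.1 + 1 : ℕ) : ℂ) * (-((1 - Complex.I) / 2 * y)) +
          ((2 * x.2 + 1 : ℕ) : ℂ) * (-((1 + Complex.I) / 2 * y)) by push_cast; ring,
      Complex.exp_add]
    ring
  simp_rw [e]
  have hc := cos_sub_cosh_eq y
  generalize Real.cos y - Real.cosh y = d at hc ⊢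
  rw [tsum_mul_left, ← h]
  push_cast
  rw [hc, mul_pow, mul_pow]
  generalize Complex.sinh ((1 - Complex.I) / 2 * y) = u
  generalize Complex.sinh ((1 + Complex.I) / 2 * y) = v
  simp only [div_eq_mul_inv, mul_inv]
  ring

lemma integrableOn_expTerm (N : ℕ) (x : ℕ × ℕ) : IntegrableOn (expTerm N x) (Set.Ioi 0) :=
  (integrableOn_pow_mul_cexp_neg_mul N (half_one_sub_I_mul_re_pos x.1 x.2)).const_mul _

lemma integral_expTerm (N : ℕ) (x : ℕ × ℕ) : ∫ y in Set.Ioi 0, expTerm N x y =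
    ((x.1 + 1).choose 2 : ℂ) * ((x.2 + 1).choose 2 : ℂ) * (N.factorial /
      ((1 - Complex.I) / 2 * (2 * x.1 + 1 + (2 * x.2 + 1) * Complex.I)) ^ (N + 1)) := by
  rw [← integral_pow_mul_cexp_neg_mul N (half_one_sub_I_mul_re_pos x.1 x.2), ← integral_const_mul]
  rfl

lemma integral_pow_mul_exp_neg_mul (N : ℕ) {r : ℝ} (hr : 0 < r) :
    ∫ y in Set.Ioi 0, y ^ N * Real.exp (-(r * y)) = N.factorial / r ^ (N + 1) := by
  have h := integral_pow_mul_cexp_neg_mul N (r := (r : ℂ)) (by simpa using hr)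
  apply Complex.ofReal_injective
  rw [← integral_complex_ofReal]
  push_cast
  exact h

lemma integral_norm_expTerm (N : ℕ) (x : ℕ × ℕ) : ∫ y in Set.Ioi 0, ‖expTerm N x y‖ =
    ((x.1 + 1).choose 2 : ℝ) * ((x.2 + 1).choose 2 : ℝ) *
      (N.factorial / ((x.1 : ℝ) + x.2 + 1) ^ (N + 1)) := by
  rw [← integral_pow_mul_exp_neg_mul N (by positivity), ← integral_const_mul]
  refine setIntegral_congr_fun measurableSet_Ioi fun y hy => ?_
  have hy : 0 < y := hy
  simp only [expTerm, norm_mul, Complex.norm_natCast, norm_pow, Complex.norm_real,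
    Complex.norm_exp, Complex.neg_re, Complex.re_mul_ofReal, half_one_sub_I_mul_re, Real.norm_of_nonneg hy.le]

lemma summable_integral_norm_expTerm {N : ℕ} (hN : 7 ≤ N) :
    Summable fun x => ∫ y in Set.Ioi 0, ‖expTerm N x y‖ := by
  simp_rw [integral_norm_expTerm]
  have h0 : Summable fun j : ℕ => 1 / ((j : ℝ) + 1) ^ 2 := by
    simpa using (summable_nat_add_iff 1).2 (Real.summable_one_div_nat_pow (p := 2).2 (by norm_num))
  have h := (h0.mul_of_nonneg h0 (fun j => by positivity) (fun j => by positivity)).mul_left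
    (N.factorial : ℝ)
  refine Summable.of_nonneg_of_le (fun x => by positivity) (fun x => ?_) h
  obtain ⟨j, k⟩ := x
  have hc (j : ℕ) : ((j + 1).choose 2 : ℝ) ≤ ((j : ℝ) + 1) ^ 2 := by
    rw [Nat.cast_choose_two]
    push_cast
    nlinarith [(Nat.cast_nonneg j : (0 : ℝ) ≤ j)]
  have hd : ((j : ℝ) + 1) ^ 4 * ((k : ℝ) + 1) ^ 4 ≤ ((j : ℝ) + k + 1) ^ (N + 1) :=
    calc _ ≤ ((j : ℝ) + k + 1) ^ 4 * ((j : ℝ) + k + 1) ^ 4 := by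
          gcongr <;> linarith [(Nat.cast_nonneg j : (0 : ℝ) ≤ j), (Nat.cast_nonneg k : (0 : ℝ) ≤ k)]
      _ = ((j : ℝ) + k + 1) ^ 8 := by ring
      _ ≤ _ := pow_le_pow_right₀
          (by linarith [(Nat.cast_nonneg j : (0 : ℝ) ≤ j), (Nat.cast_nonneg k : (0 : ℝ) ≤ k)])
          (by omega)
  calc _ ≤ ((j : ℝ) + 1) ^ 2 * ((k : ℝ) + 1) ^ 2 *
        (N.factorial / (((j : ℝ) + 1) ^ 4 * ((k : ℝ) + 1) ^ 4)) := by
        gcongr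
        · exact hc j
        · exact hc k
    _ = _ := by field_simp

lemma hasSum_integral_cos_sub_cosh {N : ℕ} (hN : 7 ≤ N) :
    HasSum (fun x : ℕ × ℕ => ((x.1 + 1).choose 2 : ℂ) * ((x.2 + 1).choose 2 : ℂ) * (N.factorial /
      ((1 - Complex.I) / 2 * (2 * x.1 + 1 + (2 * x.2 + 1) * Complex.I)) ^ (N + 1)))
      ((-1 / 8 * ∫ y in Set.Ioi 0, y ^ N / (Real.cos y - Real.cosh y) ^ 3 : ℝ) : ℂ) := by
  have h := hasSum_integral_of_summable_integral_norm (integrableOn_expTerm N)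
    (summable_integral_norm_expTerm hN)
  simp_rw [integral_expTerm] at h
  rw [setIntegral_congr_fun measurableSet_Ioi (fun y hy => tsum_expTerm N hy),
    integral_complex_ofReal, integral_const_mul] at h
  exact h

lemma one_sub_I_div_two_pow (p : ℕ) : ((1 - Complex.I) / 2) ^ (4 * p) = (-1 / 4) ^ p := by
  rw [pow_mul]
  congr 1
  linear_combination (Complex.I ^ 2 - 4 * Complex.I + 5) / 16 * Complex.I_sq

lemma hasSum_inv_odd_add_odd_mul_I_pow {p : ℕ} (hp : 2 ≤ p) :
    HasSum (fun x : ℕ × ℕ => ((x.1 + 1).choose 2 : ℂ) * ((x.2 + 1).choose 2 : ℂ) *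
      (1 / (2 * x.1 + 1 + (2 * x.2 + 1) * Complex.I) ^ (4 * p)))
      ((-1 / 8 * (-1 / 4) ^ p / (4 * p - 1).factorial *
        ∫ y in Set.Ioi 0, y ^ (4 * p - 1) / (Real.cos y - Real.cosh y) ^ 3 : ℝ) : ℂ) := by
  have h := (hasSum_integral_cos_sub_cosh (N := 4 * p - 1) (by omega)).mul_left
    ((-1 / 4) ^ p / ((4 * p - 1).factorial : ℂ))
  rw [show 4 * p - 1 + 1 = 4 * p by omega] at h
  convert! h using 1
  · ext x
    have h4 : ((-1 : ℂ) / 4) ^ p ≠ 0 := by simp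
    have hf : ((4 * p - 1).factorial : ℂ) ≠ 0 := by exact_mod_cast Nat.factorial_ne_zero _
    rw [mul_pow, one_sub_I_div_two_pow]
    generalize ((-1 : ℂ) / 4) ^ p = w at *
    generalize ((4 * p - 1).factorial : ℂ) = f at *
    field_simp
  · push_cast
    ring

lemma hasSum_choose_mul_altExpSum_comb {p : ℕ} (hp : 2 ≤ p) :
    HasSum (fun j : ℕ => ((j + 1).choose 2 : ℂ) *
      (1 / 8 * (-(π : ℂ) ^ (4 * p - 2) / (4 * p - 3).factorial * altExpSum (4 * p - 3) (2 * j + 1)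
        + 2 * (2 * j + 1) * (π ^ (4 * p - 1) / (4 * p - 2).factorial) *
          altExpSum (4 * p - 2) (2 * j + 1)
        - ((2 * j + 1) ^ 2 + 1) * (π ^ (4 * p) / (4 * p - 1).factorial) *
          altExpSum (4 * p - 1) (2 * j + 1))))
      ((-1 / 4 * (-1 / 4) ^ p / (4 * p - 1).factorial *
        ∫ y in Set.Ioi 0, y ^ (4 * p - 1) / (Real.cos y - Real.cosh y) ^ 3 : ℝ) : ℂ) := by
  have h := hasSum_inv_odd_add_odd_mul_I_pow hp
  have h' := Complex.hasSum_conj'.2 h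
  rw [Complex.conj_ofReal] at h'
  have h2 := h.add h'
  have h3 := h2.prod_fiberwise (g := fun j : ℕ => ((j + 1).choose 2 : ℂ) *
      (1 / 8 * (-(π : ℂ) ^ (4 * p - 2) / (4 * p - 3).factorial * altExpSum (4 * p - 3) (2 * j + 1)
        + 2 * (2 * j + 1) * (π ^ (4 * p - 1) / (4 * p - 2).factorial) *
          altExpSum (4 * p - 2) (2 * j + 1)
        - ((2 * j + 1) ^ 2 + 1) * (π ^ (4 * p) / (4 * p - 1).factorial) *
          altExpSum (4 * p - 1) (2 * j + 1)))) ?_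
  · convert! h3 using 1
    rw [← Complex.ofReal_add]
    congr 1
    ring
  · intro j
    have h4 := (hasSum_choose_mul_inv_pow (t := 2 * j + 1) (by positivity)
      (k := 4 * p - 3) (by omega)).mul_left ((j + 1).choose 2 : ℂ)
    rw [show 4 * p - 3 + 3 = 4 * p by omega, show 4 * p - 3 + 2 = 4 * p - 1 by omega,
      show 4 * p - 3 + 1 = 4 * p - 2 by omega] at h4
    convert! h4 using 1
    · ext m
      simp only [map_mul, map_div₀, map_pow, map_add, map_one, map_natCast, Complex.conj_I,
        Complex.conj_ofNat]
      push_cast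
      ring
    · push_cast
      ring

lemma integral_eq_tsum_div_sinh_pow {p : ℕ} (hp : 2 ≤ p) :
    ((-1 / 4 * (-1 / 4) ^ p / (4 * p - 1).factorial *
        ∫ y in Set.Ioi 0, y ^ (4 * p - 1) / (Real.cos y - Real.cosh y) ^ 3 : ℝ) : ℂ) =
      1 / 64 * (-(π : ℂ) ^ (4 * p - 2) / (4 * p - 3).factorial *
          (∑' r : ℕ, (-1 : ℂ) ^ (r + 1) * ((r : ℂ) + 1) ^ (4 * p - 3) /
            Complex.sinh (((r : ℂ) + 1) * π) ^ 3)
        + 6 * (π ^ (4 * p - 1) / (4 * p - 2).factorial) *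
          (∑' r : ℕ, (-1 : ℂ) ^ (r + 1) * ((r : ℂ) + 1) ^ (4 * p - 2) *
            Complex.cosh (((r : ℂ) + 1) * π) / Complex.sinh (((r : ℂ) + 1) * π) ^ 4)
        - (π ^ (4 * p) / (4 * p - 1).factorial) *
          (10 * (∑' r : ℕ, (-1 : ℂ) ^ (r + 1) * ((r : ℂ) + 1) ^ (4 * p - 1) /
            Complex.sinh (((r : ℂ) + 1) * π) ^ 3) +
          12 * (∑' r : ℕ, (-1 : ℂ) ^ (r + 1) * ((r : ℂ) + 1) ^ (4 * p - 1) /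
            Complex.sinh (((r : ℂ) + 1) * π) ^ 5))) := by
  have h0 (k : ℕ) := hasSum_choose_mul_altExpSum (s := 0) k (g := fun u => 1 / (8 * Complex.sinh u ^ 3))
    (fun u hu => by simpa using hasSum_one_div_sinh_cube hu)
  have h1 := hasSum_choose_mul_altExpSum (s := 1) (4 * p - 2)
    (g := fun u => 3 * Complex.cosh u / (8 * Complex.sinh u ^ 4))
    (fun u hu => by simpa using hasSum_cosh_div_sinh_pow_four hu)
  have h2 := hasSum_choose_mul_altExpSum (s := 2) (4 * p - 1)
    (g := fun u => 9 / (8 * Complex.sinh u ^ 3) + 12 / (8 * Complex.sinh u ^ 5))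
    (fun u hu => hasSum_nine_div_sinh_cube_add_twelve_div_sinh_pow_five hu)
  have e0 (k : ℕ) : ∑' r : ℕ, (-1 : ℂ) ^ (r + 1) * ((r : ℂ) + 1) ^ k *
        (1 / (8 * Complex.sinh (((r : ℂ) + 1) * π) ^ 3)) =
      1 / 8 * ∑' r : ℕ, (-1 : ℂ) ^ (r + 1) * ((r : ℂ) + 1) ^ k /
        Complex.sinh (((r : ℂ) + 1) * π) ^ 3 := by
    rw [← tsum_mul_left]
    refine tsum_congr fun r => ?_
    simp only [div_eq_mul_inv, mul_inv]; ring
  have e1 : ∑' r : ℕ, (-1 : ℂ) ^ (r + 1) * ((r : ℂ) + 1) ^ (4 * p - 2) *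
        (3 * Complex.cosh (((r : ℂ) + 1) * π) / (8 * Complex.sinh (((r : ℂ) + 1) * π) ^ 4)) =
      3 / 8 * ∑' r : ℕ, (-1 : ℂ) ^ (r + 1) * ((r : ℂ) + 1) ^ (4 * p - 2) *
            Complex.cosh (((r : ℂ) + 1) * π) / Complex.sinh (((r : ℂ) + 1) * π) ^ 4 := by
    rw [← tsum_mul_left]
    refine tsum_congr fun r => ?_
    simp only [div_eq_mul_inv, mul_inv]; ring
  have e2 : ∑' r : ℕ, (-1 : ℂ) ^ (r + 1) * ((r : ℂ) + 1) ^ (4 * p - 1) *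
        (9 / (8 * Complex.sinh (((r : ℂ) + 1) * π) ^ 3) +
          12 / (8 * Complex.sinh (((r : ℂ) + 1) * π) ^ 5)) =
      9 / 8 * (∑' r : ℕ, (-1 : ℂ) ^ (r + 1) * ((r : ℂ) + 1) ^ (4 * p - 1) /
          Complex.sinh (((r : ℂ) + 1) * π) ^ 3) +
      12 / 8 * ∑' r : ℕ, (-1 : ℂ) ^ (r + 1) * ((r : ℂ) + 1) ^ (4 * p - 1) /
          Complex.sinh (((r : ℂ) + 1) * π) ^ 5 := by
    have s3 := ((h0 (4 * p - 1)).1).mul_left 9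
    have s5 := (h2.1).sub s3
    rw [← tsum_mul_left, ← tsum_mul_left, ← Summable.tsum_add]
    · refine tsum_congr fun r => ?_
      simp only [div_eq_mul_inv, mul_inv]; ring
    · refine s3.congr fun r => ?_
      simp only [div_eq_mul_inv, mul_inv]; ring
    · refine s5.congr fun r => ?_
      simp only [div_eq_mul_inv, mul_inv]; ring
  have a0 := (h0 (4 * p - 3)).2
  have a0' := (h0 (4 * p - 1)).2
  have a1 := h1.2
  have a2 := h2.2
  rw [e0] at a0 a0'
  rw [e1] at a1
  rw [e2] at a2
  have h := (((a0.mul_left (-(π : ℂ) ^ (4 * p - 2) / (4 * p - 3).factorial)).add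
    (a1.mul_left (2 * ((π : ℂ) ^ (4 * p - 1) / (4 * p - 2).factorial)))).sub
    ((a2.add a0').mul_left ((π : ℂ) ^ (4 * p) / (4 * p - 1).factorial))).mul_left (1 / 8)
  refine (hasSum_choose_mul_altExpSum_comb hp).unique ?_
  convert! h using 1
  · ext j
    ring
  · ring

theorem cor_cos_minus_cosh (p : ℕ) (hp : 2 ≤ p) :
    ((-1 : ℝ) ^ (p-1) / (π ^ (4*p-2) * 2 ^ (2*p-3))) *
      (∫ x in Set.Ioi (0:ℝ), x ^ (4*p-1) / (Real.cos x - Real.cosh x) ^ 3) =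
    -((4*(p:ℝ) - 1) * (4*(p:ℝ) - 2) / 2) *
        (∑' n : ℕ, (-1 : ℝ) ^ (n+1) * ((n:ℝ)+1) ^ (4*p-3)
            / Real.sinh (((n:ℝ)+1) * π) ^ 3)
    + 3 * (4*(p:ℝ) - 1) * π *
        (∑' n : ℕ, (-1 : ℝ) ^ (n+1) * ((n:ℝ)+1) ^ (4*p-2)
            * Real.cosh (((n:ℝ)+1) * π) / Real.sinh (((n:ℝ)+1) * π) ^ 4)
    - 5 * π ^ 2 *
        (∑' n : ℕ, (-1 : ℝ) ^ (n+1) * ((n:ℝ)+1) ^ (4*p-1)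
            / Real.sinh (((n:ℝ)+1) * π) ^ 3)
    - 6 * π ^ 2 *
        (∑' n : ℕ, (-1 : ℝ) ^ (n+1) * ((n:ℝ)+1) ^ (4*p-1)
            / Real.sinh (((n:ℝ)+1) * π) ^ 5) := by
  have hR : -1 / 4 * (-1 / 4) ^ p / (4 * p - 1).factorial *
      (∫ y in Set.Ioi 0, y ^ (4 * p - 1) / (Real.cos y - Real.cosh y) ^ 3) =
      1 / 64 * (-π ^ (4 * p - 2) / (4 * p - 3).factorial *
          (∑' n : ℕ, (-1 : ℝ) ^ (n+1) * ((n:ℝ)+1) ^ (4*p-3)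
            / Real.sinh (((n:ℝ)+1) * π) ^ 3)
        + 6 * (π ^ (4 * p - 1) / (4 * p - 2).factorial) *
          (∑' n : ℕ, (-1 : ℝ) ^ (n+1) * ((n:ℝ)+1) ^ (4*p-2)
            * Real.cosh (((n:ℝ)+1) * π) / Real.sinh (((n:ℝ)+1) * π) ^ 4)
        - (π ^ (4 * p) / (4 * p - 1).factorial) *
          (10 * (∑' n : ℕ, (-1 : ℝ) ^ (n+1) * ((n:ℝ)+1) ^ (4*p-1)
              / Real.sinh (((n:ℝ)+1) * π) ^ 3) +
          12 * (∑' n : ℕ, (-1 : ℝ) ^ (n+1) * ((n:ℝ)+1) ^ (4*p-1)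
              / Real.sinh (((n:ℝ)+1) * π) ^ 5))) := by
    apply Complex.ofReal_injective
    refine (integral_eq_tsum_div_sinh_pow hp).trans ?_
    push_cast
    rfl
  generalize (∫ x in Set.Ioi (0:ℝ), x ^ (4*p-1) / (Real.cos x - Real.cosh x) ^ 3) = J at *
  generalize (∑' n : ℕ, (-1 : ℝ) ^ (n+1) * ((n:ℝ)+1) ^ (4*p-3)
            / Real.sinh (((n:ℝ)+1) * π) ^ 3) = A at *
  generalize (∑' n : ℕ, (-1 : ℝ) ^ (n+1) * ((n:ℝ)+1) ^ (4*p-2)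
            * Real.cosh (((n:ℝ)+1) * π) / Real.sinh (((n:ℝ)+1) * π) ^ 4) = B at *
  generalize (∑' n : ℕ, (-1 : ℝ) ^ (n+1) * ((n:ℝ)+1) ^ (4*p-1)
            / Real.sinh (((n:ℝ)+1) * π) ^ 3) = C at *
  generalize (∑' n : ℕ, (-1 : ℝ) ^ (n+1) * ((n:ℝ)+1) ^ (4*p-1)
            / Real.sinh (((n:ℝ)+1) * π) ^ 5) = D at *
  obtain ⟨q, rfl⟩ : ∃ q, p = q + 2 := ⟨p - 2, by omega⟩
  rw [show 4 * (q + 2) - 1 = 4 * q + 7 by omega, show 4 * (q + 2) - 2 = 4 * q + 6 by omega,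
    show 4 * (q + 2) - 3 = 4 * q + 5 by omega, show 4 * (q + 2) = 4 * q + 6 + 2 by omega,
    Nat.factorial_succ (4 * q + 6), Nat.factorial_succ (4 * q + 5),
    show 4 * q + 7 = 4 * q + 6 + 1 by omega] at hR
  rw [show 4 * (q + 2) - 2 = 4 * q + 6 by omega, show q + 2 - 1 = q + 1 by omega,
    show 2 * (q + 2) - 3 = 2 * q + 1 by omega]
  have hF : ((4 * q + 5).factorial : ℝ) ≠ 0 := by exact_mod_cast Nat.factorial_ne_zero _
  have hP : π ^ (4 * q + 6) ≠ 0 := pow_ne_zero _ Real.pi_ne_zero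
  have hw : (4 : ℝ) ^ q ≠ 0 := by positivity
  have h2 : (2 : ℝ) ^ (2 * q + 1) = 2 * 4 ^ q := by rw [pow_succ, pow_mul]; norm_num; ring
  have h4 : (-1 / 4 : ℝ) ^ (q + 2) = (-1) ^ q / (16 * 4 ^ q) := by
    rw [div_pow, pow_add, pow_add]; norm_num; ring
  rw [h2, pow_succ (-1 : ℝ) q]
  rw [h4] at hR
  simp only [pow_add π (4 * q + 6)] at hR
  push_cast at hR ⊢
  generalize π ^ (4 * q + 6) = P at *
  generalize ((4 * q + 5).factorial : ℝ) = F at *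
  generalize (4 : ℝ) ^ q = w at *
  generalize (-1 : ℝ) ^ q = s at *
  have h7 : 4 * (q : ℝ) + 6 + 1 ≠ 0 := by positivity
  have h6 : 4 * (q : ℝ) + 5 + 1 ≠ 0 := by positivity
  field_simp at hR ⊢
  linear_combination hR / 64
end
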